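/- arXiv:math/0602610 — 9 statements merged into one kernel-verified Lean document; each statement's English description precedes it below -/
import Mathlib

section
/- Let n ≥ 1 and let l be a list of natural numbers that is a permutation of the list (0, 1, ..., n−1), with des(l) = k. Then among the n+1 lists obtained from l by inserting the value n at one of the positions 0, 1, ..., n, exactly k+1 of them have des equal to k, and exactly n−k of them have des equal to k+1. -/
/-- Number of descents of a list: indices `i ≤ l.length - 2` with `l[i] > l[i+1]`. -/
def desL (l : List ℕ) : ℕ :=
  ((Finset.range (l.length - 1)).filter (fun i => l.getD (i + 1) 0 < l.getD i 0)).card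

/-- Insert the value `v` at position `i` in the list `l`. -/
def insertAt (l : List ℕ) (i : ℕ) (v : ℕ) : List ℕ := l.take i ++ v :: l.drop i

theorem desL_cons_cons (a b : ℕ) (t : List ℕ) :
    desL (a :: b :: t) = desL (b :: t) + (if b < a then 1 else 0) := by
  unfold desL
  simp only [Finset.card_filter, List.length_cons, Nat.add_sub_cancel]
  rw [Finset.sum_range_succ']
  simp

theorem desL_single (a : ℕ) : desL [a] = 0 := by
  simp [desL]

theorem insert_count (m : ℕ) : ∀ (t : List ℕ) (a : ℕ), (∀ x ∈ a :: t, x < m) →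
    (∑ i ∈ Finset.range (t.length + 1),
      if desL (insertAt (a :: t) (i + 1) m) = desL (a :: t) then 1 else 0) = desL (a :: t) + 1 ∧
    (∑ i ∈ Finset.range (t.length + 1),
      if desL (insertAt (a :: t) (i + 1) m) = desL (a :: t) + 1 then 1 else 0)
        + desL (a :: t) = t.length := by
  intro t
  induction t with
  | nil =>
    intro a h
    have ha : a < m := h a (by simp)
    have ha' : ¬ m < a := by omega
    simp [insertAt, desL_cons_cons, desL_single, ha']
  | cons b t ih =>
    intro a h
    have ha : a < m := h a (by simp)
    have hb : b < m := h b (by simp)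
    have ha' : ¬ m < a := by omega
    obtain ⟨h1, h2⟩ := ih b (fun x hx => h x (List.mem_cons_of_mem _ hx))
    have e0 : desL (insertAt (a :: b :: t) (0 + 1) m) = desL (b :: t) + 1 := by
      simp [insertAt, desL_cons_cons a m, desL_cons_cons m b, ha', hb]
    have e1 : ∀ i, desL (insertAt (a :: b :: t) (i + 1 + 1) m)
        = desL (insertAt (b :: t) (i + 1) m) + (if b < a then 1 else 0) := by
      intro i
      simp only [insertAt, List.take_succ_cons, List.drop_succ_cons, List.cons_append]
      rw [desL_cons_cons]
    rw [List.length_cons, Finset.sum_range_succ', Finset.sum_range_succ' _ (t.length + 1), e0,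
      desL_cons_cons a b]
    simp only [e1]
    by_cases hba : b < a
    · simp only [hba, if_true, Nat.add_right_cancel_iff]
      rw [h1]
      constructor
      · simp
      · simp at h2 ⊢
        omega
    · simp only [hba, if_false, Nat.add_zero]
      rw [h1]
      constructor
      · simp
      · simp at h2 ⊢
        omega

theorem stmt0 (n k : ℕ) (hn : 1 ≤ n) (l : List ℕ)
    (hperm : l.Perm (List.range n)) (hdes : desL l = k) :
    ((Finset.range (n + 1)).filter (fun i => desL (insertAt l i n) = k)).card = k + 1 ∧
    ((Finset.range (n + 1)).filter (fun i => desL (insertAt l i n) = k + 1)).card = n - k := by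
  have hlen : l.length = n := by simpa using hperm.length_eq
  have hlt : ∀ x ∈ l, x < n := fun x hx => by simpa using hperm.mem_iff.1 hx
  subst hdes
  cases l with
  | nil => simp at hlen; omega
  | cons a t =>
    obtain ⟨h1, h2⟩ := insert_count n t a hlt
    have ha : a < n := hlt a (by simp)
    have e0 : desL (insertAt (a :: t) 0 n) = desL (a :: t) + 1 := by
      simp [insertAt, desL_cons_cons n a, ha]
    rw [List.length_cons] at hlen
    rw [hlen] at h1 h2
    simp only [Finset.card_filter]
    rw [Finset.sum_range_succ', Finset.sum_range_succ' _ n, e0, h1]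
    simp only [if_true]
    constructor
    · simp
    · omega
end

section
/- For every V ∈ 𝒱 and every n ≥ 1, the sum over k = 0, ..., n−1 of ⟨n,k⟩·V n k equals 1, where ⟨n,k⟩ is the Eulerian number. -/
/-- Number of descents of a permutation of `Fin n`: indices `j` with `j+1 < n`
and `π j > π (j+1)`. -/
noncomputable def descents {n : ℕ} (π : Equiv.Perm (Fin n)) : ℕ :=
  Nat.card {j : Fin n // ∃ h : (j : ℕ) + 1 < n, π ⟨(j : ℕ) + 1, h⟩ < π j}

/-- The Eulerian number `⟨n,k⟩`: the number of permutations of `Fin n` with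
exactly `k` descents. -/
noncomputable def eulerian (n k : ℕ) : ℕ :=
  Nat.card {π : Equiv.Perm (Fin n) // descents π = k}

/-- The convex set `𝒱` of nonnegative normalized solutions to the dual recursion. -/
def memV (V : ℕ → ℕ → ℝ) : Prop :=
  (∀ n k : ℕ, n = 0 ∨ n ≤ k → V n k = 0) ∧
  (∀ n k : ℕ, 0 ≤ V n k) ∧
  V 1 0 = 1 ∧
  (∀ n k : ℕ, 1 ≤ n → k ≤ n - 1 →
    V n k = ((k : ℝ) + 1) * V (n + 1) k + ((n : ℝ) - (k : ℝ)) * V (n + 1) (k + 1))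

/-- Word of a permutation as a function on the naturals. -/
def word {n : ℕ} (π : Equiv.Perm (Fin n)) (j : ℕ) : ℕ :=
  if h : j < n then (π ⟨j, h⟩ : ℕ) else 0

/-- Descent count of a word of length `m + 1`. -/
def dcount (w : ℕ → ℕ) (m : ℕ) : ℕ := ∑ j ∈ Finset.range m, if w (j + 1) < w j then 1 else 0

/-- Insert the letter `M` at position `p`. -/
def ins (w : ℕ → ℕ) (p M : ℕ) (j : ℕ) : ℕ :=
  if j < p then w j else if j = p then M else w (j - 1)

lemma dcount_le (w : ℕ → ℕ) (m : ℕ) : dcount w m ≤ m := by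
  unfold dcount
  calc _ ≤ ∑ j ∈ Finset.range m, 1 := Finset.sum_le_sum (fun j _ => by split_ifs <;> simp)
    _ = m := by simp

lemma dcount_congr (w v : ℕ → ℕ) (m : ℕ) (h : ∀ j ≤ m, w j = v j) : dcount w m = dcount v m := by
  unfold dcount
  refine Finset.sum_congr rfl fun j hj => ?_
  have := Finset.mem_range.1 hj
  rw [h j (by omega), h (j + 1) (by omega)]

lemma dcount_succ (w : ℕ → ℕ) (m : ℕ) :
    dcount w (m + 1) = dcount w m + if w (m + 1) < w m then 1 else 0 := by
  unfold dcount
  rw [Finset.sum_range_succ]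

lemma dcount_ins_last (w : ℕ → ℕ) (M m : ℕ) (hw : ∀ j ≤ m, w j < M) :
    dcount (ins w (m + 1) M) (m + 1) = dcount w m := by
  rw [dcount_succ, dcount_congr _ w]
  · have := hw m le_rfl
    simp [ins]; omega
  · intro j hj
    simp [ins]; omega

lemma dcount_ins (w : ℕ → ℕ) (M m p : ℕ) (hw : ∀ j ≤ m, w j < M) (hp : p ≤ m) :
    dcount (ins w p M) (m + 1) =
      if 1 ≤ p ∧ w p < w (p - 1) then dcount w m else dcount w m + 1 := by
  induction m with
  | zero =>
    obtain rfl : p = 0 := by omega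
    have := hw 0 le_rfl
    simp only [dcount, Finset.sum_range_one, Finset.sum_range_zero, zero_add]
    simp [ins, this]
  | succ m ih =>
    rcases Nat.lt_or_ge m p with h | h
    · obtain rfl : p = m + 1 := by omega
      rw [dcount_succ, dcount_ins_last _ _ _ (fun j hj => hw j (by omega)), dcount_succ w m]
      have := hw (m + 1) le_rfl
      simp [ins, this]
      split_ifs <;> omega
    · rw [dcount_succ, ih (fun j hj => hw j (by omega)) h, dcount_succ w m]
      have e1 : ins w p M (m + 1 + 1) = w (m + 1) := by
        unfold ins; rw [if_neg (by omega), if_neg (by omega)]; rfl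
      have e2 : ins w p M (m + 1) = w m := by
        unfold ins; rw [if_neg (by omega), if_neg (by omega)]; rfl
      rw [e1, e2]
      split_ifs <;> omega

lemma sum_ins (w : ℕ → ℕ) (M m : ℕ) (hw : ∀ j ≤ m, w j < M) (f : ℕ → ℝ) :
    ∑ p ∈ Finset.range (m + 2), f (dcount (ins w p M) (m + 1)) =
      ((dcount w m : ℝ) + 1) * f (dcount w m)
        + (((m + 1 : ℕ) : ℝ) - (dcount w m : ℝ)) * f (dcount w m + 1) := by
  rw [Finset.sum_range_succ, dcount_ins_last _ _ _ hw, Finset.sum_range_succ',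
    dcount_ins _ _ _ _ hw (Nat.zero_le _)]
  have key : ∑ j ∈ Finset.range m, f (dcount (ins w (j + 1) M) (m + 1)) =
      ∑ j ∈ Finset.range m, (f (dcount w m + 1) +
        ((if w (j + 1) < w j then 1 else 0 : ℕ) : ℝ) * (f (dcount w m) - f (dcount w m + 1))) := by
    refine Finset.sum_congr rfl fun j hj => ?_
    have := Finset.mem_range.1 hj
    rw [dcount_ins _ _ _ _ hw (by omega)]
    by_cases h : w (j + 1) < w j <;> simp [h]
  rw [key, Finset.sum_add_distrib, ← Finset.sum_mul, ← Nat.cast_sum]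
  change _ + (dcount w m : ℝ) * _ + _ + _ = _
  simp
  ring

lemma descents_eq (m : ℕ) (π : Equiv.Perm (Fin (m + 1))) : descents π = dcount (word π) m := by
  classical
  unfold descents dcount
  rw [Nat.card_eq_fintype_card, Fintype.card_subtype, Finset.card_filter,
    Fin.sum_univ_castSucc, ← Fin.sum_univ_eq_sum_range
      (fun j => if word π (j + 1) < word π j then 1 else 0)]
  rw [if_neg (by simp), add_zero]
  refine Finset.sum_congr rfl fun j _ => ?_
  have hj := j.2
  have e1 : word π (j + 1) = π ⟨j + 1, by omega⟩ := by
    unfold word; rw [dif_pos (by omega)]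
  have e2 : word π j = π j.castSucc := by
    unfold word; rw [dif_pos (by omega)]; rfl
  rw [e1, e2]
  refine if_congr ⟨?_, ?_⟩ rfl rfl
  · rintro ⟨h, h'⟩; exact h'
  · intro h; exact ⟨by simp, h⟩

/-- Insert the maximum at position `p`. -/
def insPerm {n : ℕ} (x : Equiv.Perm (Fin n) × Fin (n + 1)) : Equiv.Perm (Fin (n + 1)) :=
  (finSuccEquiv' x.2).trans ((Equiv.optionCongr x.1).trans (finSuccEquiv' (Fin.last n)).symm)

lemma insPerm_self {n : ℕ} (x : Equiv.Perm (Fin n) × Fin (n + 1)) :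
    insPerm x x.2 = Fin.last n := by
  simp [insPerm]

lemma insPerm_succAbove {n : ℕ} (x : Equiv.Perm (Fin n) × Fin (n + 1)) (j : Fin n) :
    insPerm x (x.2.succAbove j) = (x.1 j).castSucc := by
  simp [insPerm]

lemma insPerm_bij (n : ℕ) : Function.Bijective (insPerm (n := n)) := by
  classical
  rw [Fintype.bijective_iff_injective_and_card]
  constructor
  · rintro ⟨π, p⟩ ⟨π', p'⟩ h
    have h1 := insPerm_self (π, p)
    rw [h, ← insPerm_self (π', p')] at h1
    have h2 : p = p' := (insPerm (π', p')).injective h1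
    subst h2
    congr 1
    ext j
    have a := insPerm_succAbove (π, p) j
    rw [h, insPerm_succAbove (π', p) j] at a
    exact (congrArg Fin.val a).symm
  · simp [Fintype.card_perm, Nat.factorial_succ, mul_comm]

lemma word_insPerm {n : ℕ} (π : Equiv.Perm (Fin n)) (p : Fin (n + 1)) (j : ℕ) (hj : j ≤ n) :
    word (insPerm (π, p)) j = ins (word π) p n j := by
  have hp := p.2
  unfold word ins
  rw [dif_pos (by omega)]
  rcases lt_trichotomy j p with h | h | h
  · have := insPerm_succAbove (π, p) ⟨j, by omega⟩
    rw [Fin.succAbove_of_castSucc_lt _ _ (by simpa [Fin.lt_def] using h)] at this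
    rw [if_pos h]
    beta_reduce
    rw [dif_pos (by omega)]
    exact congrArg Fin.val this
  · subst h
    have := insPerm_self (π, p)
    simpa using congrArg Fin.val this
  · have := insPerm_succAbove (π, p) ⟨j - 1, by omega⟩
    rw [Fin.succAbove_of_le_castSucc _ _ (by simp [Fin.le_def]; omega)] at this
    rw [if_neg (by omega), if_neg (by omega)]
    beta_reduce
    rw [dif_pos (by omega)]
    have e : (⟨j, by omega⟩ : Fin (n + 1)) = Fin.succ ⟨j - 1, by omega⟩ := by
      ext; simp; omega
    rw [e]
    exact congrArg Fin.val this

lemma sum_perm_succ (m : ℕ) (f : ℕ → ℝ) :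
    ∑ σ : Equiv.Perm (Fin (m + 2)), f (descents σ) =
      ∑ π : Equiv.Perm (Fin (m + 1)), (((descents π : ℝ) + 1) * f (descents π)
        + (((m + 1 : ℕ) : ℝ) - (descents π : ℝ)) * f (descents π + 1)) := by
  rw [← (insPerm_bij (m + 1)).sum_comp (fun σ => f (descents σ)), Fintype.sum_prod_type]
  refine Finset.sum_congr rfl fun π _ => ?_
  rw [descents_eq, ← sum_ins (word π) (m + 1) m _ f,
    ← Fin.sum_univ_eq_sum_range (fun p => f (dcount (ins (word π) p (m + 1)) (m + 1)))]
  · refine Finset.sum_congr rfl fun p _ => ?_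
    rw [descents_eq, dcount_congr _ _ _ (fun j hj => word_insPerm π p j hj)]
  · intro j hj
    unfold word
    rw [dif_pos (by omega)]
    exact Fin.is_lt _

lemma sum_eulerian (m : ℕ) (f : ℕ → ℝ) :
    ∑ k ∈ Finset.range (m + 1), (eulerian (m + 1) k : ℝ) * f k =
      ∑ π : Equiv.Perm (Fin (m + 1)), f (descents π) := by
  classical
  rw [← Finset.sum_fiberwise_of_maps_to (s := Finset.univ) (t := Finset.range (m + 1))
    (g := fun π : Equiv.Perm (Fin (m + 1)) => descents π)]
  · refine Finset.sum_congr rfl fun k _ => ?_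
    rw [Finset.sum_congr rfl (g := fun _ => f k)
      (fun π hπ => by rw [(Finset.mem_filter.1 hπ).2])]
    rw [Finset.sum_const, nsmul_eq_mul, eulerian, Nat.card_eq_fintype_card, Fintype.card_subtype]
  · intro π _
    have := dcount_le (word π) m
    rw [Finset.mem_range, descents_eq]
    omega

theorem stmt2 (V : ℕ → ℕ → ℝ) (hV : memV V) (n : ℕ) (hn : 1 ≤ n) :
    ∑ k ∈ Finset.range n, (eulerian n k : ℝ) * V n k = 1 := by
  obtain ⟨_, _, h1, hrec⟩ := hV
  obtain ⟨m, rfl⟩ : ∃ m, n = m + 1 := ⟨n - 1, by omega⟩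
  rw [sum_eulerian]
  clear hn
  induction m with
  | zero =>
    simp [descents_eq, dcount, h1]
  | succ m ih =>
    rw [sum_perm_succ]
    refine Eq.trans ?_ ih
    refine Finset.sum_congr rfl fun π _ => ?_
    have := dcount_le (word π) m
    rw [hrec (m + 1) (descents π) (by omega) (by rw [descents_eq]; omega)]
end

section
/- If V, V' ∈ 𝒱 satisfy V n 0 = V' n 0 for all n ≥ 1, then V = V', i.e. V n k = V' n k for all n and k. -/
theorem stmt3 (V V' : ℕ → ℕ → ℝ) (hV : memV V) (hV' : memV V')
    (h : ∀ n : ℕ, 1 ≤ n → V n 0 = V' n 0) : V = V' := by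
  obtain ⟨z, -, -, r⟩ := hV
  obtain ⟨z', -, -, r'⟩ := hV'
  have key : ∀ k n : ℕ, V n k = V' n k := by
    intro k
    induction k with
    | zero =>
      intro n
      rcases Nat.eq_zero_or_pos n with hn | hn
      · rw [z n 0 (Or.inl hn), z' n 0 (Or.inl hn)]
      · exact h n hn
    | succ k ih =>
      intro n
      by_cases hn : n ≤ k + 1
      · rw [z n _ (Or.inr hn), z' n _ (Or.inr hn)]
      · obtain ⟨m, rfl⟩ : ∃ m, n = m + 1 := ⟨n - 1, by omega⟩
        have h1 := r m k (by omega) (by omega)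
        have h2 := r' m k (by omega) (by omega)
        rw [ih m, ih (m + 1)] at h1
        have hlt : (k : ℝ) < (m : ℝ) := by
          have : k < m := by omega
          exact_mod_cast this
        have hne : (m : ℝ) - (k : ℝ) ≠ 0 := (sub_pos.mpr hlt).ne'
        exact mul_left_cancel₀ hne (by linarith)
  funext n k
  exact key k n
end

section
/- For every κ ∈ ℕ, the function W^κ belongs to 𝒱; in particular, for all n ≥ 1 and 0 ≤ k ≤ n−1, C(n+κ−k, n)/(κ+1)^n = (k+1)·C(n+1+κ−k, n+1)/(κ+1)^{n+1} + (n−k)·C(n+κ−k, n+1)/(κ+1)^{n+1}. -/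
/-- The array `W^κ` produced by bucket sorting with `κ+1` buckets. -/
noncomputable def Wbucket (κ : ℕ) (n k : ℕ) : ℝ :=
  if 1 ≤ n ∧ k ≤ n - 1 then (Nat.choose (n + κ - k) n : ℝ) / ((κ : ℝ) + 1) ^ n else 0

/-- The array `Ŵ^κ` (the image of `W^κ` under the symmetry of the triangle). -/
noncomputable def Whatbucket (κ : ℕ) (n k : ℕ) : ℝ :=
  if 1 ≤ n ∧ k ≤ n - 1 then (Nat.choose (κ + k + 1) n : ℝ) / ((κ : ℝ) + 1) ^ n else 0

/-- The array `W^∞` corresponding to the exchangeable random arrangement. -/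
noncomputable def Winf (n k : ℕ) : ℝ :=
  if 1 ≤ n ∧ k ≤ n - 1 then 1 / (Nat.factorial n : ℝ) else 0

theorem bucket_key (κ n k : ℕ) (hn : 1 ≤ n) (hk : k ≤ n - 1) :
    ((κ : ℝ) + 1) * (Nat.choose (n + κ - k) n : ℝ) =
      ((k : ℝ) + 1) * (Nat.choose (n + 1 + κ - k) (n + 1) : ℝ) +
      ((n : ℝ) - (k : ℝ)) * (Nat.choose (n + κ - k) (n + 1) : ℝ) := by
  have e : n + 1 + κ - k = (n + κ - k) + 1 := by omega
  rw [e, Nat.choose_succ_succ]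
  by_cases h : k ≤ κ
  · have h1 := Nat.choose_succ_right_eq (n + κ - k) n
    have e2 : n + κ - k - n = κ - k := by omega
    rw [e2] at h1
    have h2 : (Nat.choose (n + κ - k) (n + 1) : ℝ) * ((n : ℝ) + 1) =
        (Nat.choose (n + κ - k) n : ℝ) * ((κ : ℝ) - k) := by
      rw [← Nat.cast_sub h]
      exact_mod_cast h1
    push_cast
    linear_combination -h2
  · rw [Nat.choose_eq_zero_of_lt (show n + κ - k < n by omega),
      Nat.choose_eq_zero_of_lt (show n + κ - k < n + 1 by omega)]
    simp

theorem bucket_rec (κ n k : ℕ) (hn : 1 ≤ n) (hk : k ≤ n - 1) :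
    (Nat.choose (n + κ - k) n : ℝ) / ((κ : ℝ) + 1) ^ n =
        ((k : ℝ) + 1) * (Nat.choose (n + 1 + κ - k) (n + 1) : ℝ) / ((κ : ℝ) + 1) ^ (n + 1) +
        ((n : ℝ) - (k : ℝ)) * (Nat.choose (n + κ - k) (n + 1) : ℝ) / ((κ : ℝ) + 1) ^ (n + 1) := by
  have hpos : ((κ : ℝ) + 1) ≠ 0 := by positivity
  rw [← add_div, ← bucket_key κ n k hn hk, pow_succ']
  rw [mul_div_mul_left _ _ hpos]

theorem stmt6 (κ : ℕ) :
    memV (Wbucket κ) ∧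
    (∀ n k : ℕ, 1 ≤ n → k ≤ n - 1 →
      (Nat.choose (n + κ - k) n : ℝ) / ((κ : ℝ) + 1) ^ n =
        ((k : ℝ) + 1) * (Nat.choose (n + 1 + κ - k) (n + 1) : ℝ) / ((κ : ℝ) + 1) ^ (n + 1) +
        ((n : ℝ) - (k : ℝ)) * (Nat.choose (n + κ - k) (n + 1) : ℝ) / ((κ : ℝ) + 1) ^ (n + 1)) := by
  refine ⟨⟨?_, ?_, ?_, ?_⟩, fun n k hn hk => bucket_rec κ n k hn hk⟩
  · intro n k h
    unfold Wbucket
    rw [if_neg (by omega)]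
  · intro n k
    unfold Wbucket
    split_ifs
    · positivity
    · exact le_rfl
  · have hpos : ((κ : ℝ) + 1) ≠ 0 := by positivity
    unfold Wbucket
    rw [if_pos (by omega), Nat.sub_zero, Nat.choose_one_right, pow_one]
    push_cast
    rw [add_comm, div_self hpos]
  · intro n k hn hk
    unfold Wbucket
    rw [if_pos ⟨hn, hk⟩, if_pos (by omega), if_pos (by omega), bucket_rec κ n k hn hk,
      show n + 1 + κ - (k + 1) = n + κ - k by omega, mul_div_assoc, mul_div_assoc]
end

section
/- For every κ ∈ ℕ, W^κ is an extreme point of 𝒱: if W^κ = t·V₁ + (1−t)·V₂ with V₁, V₂ ∈ 𝒱 and 0 < t < 1, then V₁ = V₂ = W^κ. -/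
lemma Wb_tendsto (κ m n : ℕ) (hm : m < κ) (C : ℝ) :
    Filter.Tendsto (fun j : ℕ => ((m : ℝ) + 1) ^ j *
      (C * (((n + j + κ : ℕ) : ℝ) ^ κ / ((κ : ℝ) + 1) ^ (n + j)))) Filter.atTop (nhds 0) := by
  have hκ : (0 : ℝ) < (κ : ℝ) + 1 := by positivity
  have hmκ : (m : ℝ) < κ := by exact_mod_cast hm
  set r : ℝ := ((m : ℝ) + 1) / ((κ : ℝ) + 1) with hr
  have hr0 : 0 < r := by positivity
  have hr1 : r < 1 := by rw [hr, div_lt_one hκ]; linarith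
  have h1 := tendsto_pow_const_mul_const_pow_of_lt_one κ hr0.le hr1
  have h2 := (h1.comp (Filter.tendsto_add_atTop_nat (n + κ))).const_mul
    (C / ((κ : ℝ) + 1) ^ n / r ^ (n + κ))
  rw [mul_zero] at h2
  refine h2.congr fun j => ?_
  have e : j + (n + κ) = n + j + κ := by omega
  have e2 : r ^ (n + j + κ) = r ^ (n + κ) * r ^ j := by
    rw [← pow_add]; congr 1; omega
  have e3 : r ^ j = ((m : ℝ) + 1) ^ j / ((κ : ℝ) + 1) ^ j := by rw [hr, div_pow]
  have hp : r ^ (n + κ) ≠ 0 := by positivity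
  simp only [Function.comp, e, e2, pow_add ((κ : ℝ) + 1)]
  rw [e3]
  generalize r ^ (n + κ) = q at hp
  field_simp

lemma Wb_le (κ n k : ℕ) : Wbucket κ n k ≤ ((n + κ : ℕ) : ℝ) ^ κ / ((κ : ℝ) + 1) ^ n := by
  unfold Wbucket
  split_ifs
  · gcongr
    have h1 : Nat.choose (n + κ - k) n ≤ Nat.choose (n + κ) n :=
      Nat.choose_le_choose _ (by omega)
    have h2 : Nat.choose (n + κ) n = Nat.choose (n + κ) κ := Nat.choose_symm_add
    have h3 := Nat.choose_le_pow (n + κ) κ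
    exact_mod_cast h1.trans (h2.le.trans h3)
  · positivity

lemma Wb_zero (κ n k : ℕ) (hk : κ < k) : Wbucket κ n k = 0 := by
  unfold Wbucket
  split_ifs
  · rw [Nat.choose_eq_zero_of_lt (by omega)]; simp
  · rfl

lemma U_zero (κ : ℕ) (U : ℕ → ℕ → ℝ) (C : ℝ)
    (hrec : ∀ n k : ℕ, k < n →
      U n k = ((k : ℝ) + 1) * U (n + 1) k + ((n : ℝ) - (k : ℝ)) * U (n + 1) (k + 1))
    (hC : 0 ≤ C) (hb : ∀ n k : ℕ, |U n k| ≤ C * Wbucket κ n k)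
    (h0 : U (κ + 1) κ = 0) (n k : ℕ) (hk : k < n) : U n k = 0 := by
  have hbig : ∀ n k, κ < k → U n k = 0 := by
    intro n k hk
    have := hb n k
    rw [Wb_zero κ n k hk, mul_zero] at this
    exact abs_nonpos_iff.mp this
  have hκ : ∀ j, U (κ + 1 + j) κ = 0 := by
    intro j
    induction j with
    | zero => exact h0
    | succ j ih =>
      have := hrec (κ + 1 + j) κ (by omega)
      rw [ih, hbig _ (κ + 1) (by omega), mul_zero, add_zero] at this
      have hne : (κ : ℝ) + 1 ≠ 0 := by positivity
      exact (mul_eq_zero.mp this.symm).resolve_left hne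
  have main : ∀ d m, m + d = κ → ∀ n, m < n → U n m = 0 := by
    intro d
    induction d with
    | zero =>
      intro m hm n hn
      obtain rfl : m = κ := by omega
      obtain ⟨j, rfl⟩ := Nat.exists_eq_add_of_le (show m + 1 ≤ n from hn)
      exact hκ j
    | succ d ih =>
      intro m hm n hn
      have hg : ∀ j, U n m = ((m : ℝ) + 1) ^ j * U (n + j) m := by
        intro j
        induction j with
        | zero => simp
        | succ j ihj =>
          rw [ihj, hrec (n + j) m (by omega), ih (m + 1) (by omega) (n + j + 1) (by omega)]
          rw [← add_assoc]; ring
      have hle : ∀ j : ℕ, |U n m| ≤ ((m : ℝ) + 1) ^ j *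
          (C * (((n + j + κ : ℕ) : ℝ) ^ κ / ((κ : ℝ) + 1) ^ (n + j))) := by
        intro j
        rw [hg j, abs_mul, abs_of_nonneg (by positivity)]
        gcongr
        exact (hb _ _).trans (mul_le_mul_of_nonneg_left (Wb_le _ _ _) hC)
      have := ge_of_tendsto' (Wb_tendsto κ m n (by omega) C) hle
      exact abs_nonpos_iff.mp this
  by_cases hkκ : κ < k
  · exact hbig n k hkκ
  · exact main (κ - k) k (by omega) n hk

lemma half (κ : ℕ) (t : ℝ) (V₁ V₂ : ℕ → ℕ → ℝ)
    (hV₁ : memV V₁) (hV₂ : memV V₂) (ht₀ : 0 < t) (ht₁ : t < 1)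
    (h : ∀ n k : ℕ, Wbucket κ n k = t * V₁ n k + (1 - t) * V₂ n k) :
    V₁ = Wbucket κ := by
  obtain ⟨z1, p1, o1, r1⟩ := hV₁
  obtain ⟨z2, p2, o2, r2⟩ := hV₂
  have hW0 : ∀ n k, 0 ≤ Wbucket κ n k := by
    intro n k; unfold Wbucket; split_ifs <;> positivity
  have hWκ : Wbucket κ (κ + 1) κ ≠ 0 := by
    unfold Wbucket
    rw [if_pos (by omega), show κ + 1 + κ - κ = κ + 1 by omega, Nat.choose_self]
    positivity
  set a := V₁ (κ + 1) κ / Wbucket κ (κ + 1) κ with ha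
  have ha0 : 0 ≤ a := div_nonneg (p1 _ _) (hW0 _ _)
  have hU : ∀ n k, k < n → V₁ n k - a * Wbucket κ n k = 0 := by
    refine U_zero κ (fun n k => V₁ n k - a * Wbucket κ n k) (1 / t + a) ?_ (by positivity) ?_ ?_
    · intro n k hk
      have e1 := r1 n k (by omega) (by omega)
      have e2 := r2 n k (by omega) (by omega)
      simp only [h]
      linear_combination (1 - a * t) * e1 - a * (1 - t) * e2
    · intro n k
      have hV : V₁ n k ≤ 1 / t * Wbucket κ n k := by
        rw [one_div, ← div_eq_inv_mul, le_div_iff₀ ht₀, h]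
        nlinarith [mul_nonneg (sub_nonneg.mpr ht₁.le) (p2 n k)]
      have := p1 n k
      have := mul_nonneg ha0 (hW0 n k)
      have : 0 ≤ 1 / t * Wbucket κ n k := mul_nonneg (by positivity) (hW0 n k)
      rw [abs_le]; constructor <;> nlinarith
    · simp only [ha]
      field_simp
      simp
  have hW1 : Wbucket κ 1 0 = 1 := by rw [h, o1, o2]; ring
  have ha1 : a = 1 := by
    have := hU 1 0 (by omega)
    rw [o1, hW1] at this
    linarith
  funext n k
  by_cases hk : k < n
  · have := hU n k hk
    rw [ha1] at this; linarith
  · rw [h, z1 n k (by omega), z2 n k (by omega)]; ring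

theorem stmt7 (κ : ℕ) (t : ℝ) (V₁ V₂ : ℕ → ℕ → ℝ)
    (hV₁ : memV V₁) (hV₂ : memV V₂) (ht₀ : 0 < t) (ht₁ : t < 1)
    (h : ∀ n k : ℕ, Wbucket κ n k = t * V₁ n k + (1 - t) * V₂ n k) :
    V₁ = Wbucket κ ∧ V₂ = Wbucket κ :=  by
  refine ⟨half κ t V₁ V₂ hV₁ hV₂ ht₀ ht₁ h, 
    half κ (1 - t) V₂ V₁ hV₂ hV₁ (by linarith) (by linarith) fun n k => ?_⟩
  rw [h]; ring
end

section
/- For every κ ∈ ℕ, the function Ŵ^κ belongs to 𝒱 and is an extreme point of 𝒱: if Ŵ^κ = t·V₁ + (1−t)·V₂ with V₁, V₂ ∈ 𝒱 and 0 < t < 1, then V₁ = V₂ = Ŵ^κ. -/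
open Filter Topology

/-- The diagonal reindexing of `Whatbucket`. -/
noncomputable def WE (κ j m : ℕ) : ℝ :=
  (Nat.choose (κ + m + 1) (j + 1 + m) : ℝ) / ((κ : ℝ) + 1) ^ (j + 1 + m)

theorem What_eq_WE (κ j m : ℕ) : Whatbucket κ (j + 1 + m) m = WE κ j m := by
  unfold Whatbucket WE
  rw [if_pos (by omega)]

theorem WE_nonneg (κ j m : ℕ) : 0 ≤ WE κ j m := by
  unfold WE; positivity

theorem WE_rec (κ j m : ℕ) :
    WE κ j m = ((m : ℝ) + 1) * WE κ (j + 1) m + ((j : ℝ) + 1) * WE κ j (m + 1) := by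
  have hk : ((κ : ℝ) + 1) ≠ 0 := by positivity
  have h1 : Nat.choose (κ + (m + 1) + 1) (j + 1 + (m + 1)) =
      Nat.choose (κ + m + 1) (j + 1 + m) + Nat.choose (κ + m + 1) (j + 1 + m + 1) :=
    Nat.choose_succ_succ _ _
  have h2 : (Nat.choose (κ + m + 1) (j + 1 + m + 1) : ℝ) * ((j : ℝ) + 1 + m + 1)
      = Nat.choose (κ + m + 1) (j + 1 + m) * ((κ : ℝ) - j) := by
    rcases le_or_gt j κ with h | h
    · have := Nat.choose_succ_right_eq (κ + m + 1) (j + 1 + m)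
      rw [show κ + m + 1 - (j + 1 + m) = κ - j by omega] at this
      have h3 : ((Nat.choose (κ + m + 1) (j + 1 + m + 1) * (j + 1 + m + 1) : ℕ) : ℝ)
        = ((Nat.choose (κ + m + 1) (j + 1 + m) * (κ - j) : ℕ) : ℝ) := by rw [this]
      push_cast [Nat.cast_sub h] at h3
      exact h3
    · rw [Nat.choose_eq_zero_of_lt (by omega : κ + m + 1 < j + 1 + m + 1),
        Nat.choose_eq_zero_of_lt (by omega : κ + m + 1 < j + 1 + m)]
      simp
  unfold WE
  rw [h1, show j + 1 + 1 + m = j + 1 + m + 1 by ring, show j + 1 + (m + 1) = j + 1 + m + 1 by ring,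
    pow_succ]
  push_cast
  field_simp
  linear_combination -h2

theorem core (κ : ℕ) (E : ℕ → ℕ → ℝ) (C : ℝ)
    (hrec : ∀ j m, E j m = ((m : ℝ) + 1) * E (j + 1) m + ((j : ℝ) + 1) * E j (m + 1))
    (hb : ∀ j m, |E j m| ≤ C * WE κ j m) (h0 : E κ 0 = 0) : ∀ j m, E j m = 0 := by
  have big : ∀ j m, κ < j → E j m = 0 := by
    intro j m hj
    have := hb j m
    unfold WE at this
    rw [Nat.choose_eq_zero_of_lt (by omega)] at this
    simpa using this
  have step : ∀ j, (∀ m, E (j + 1) m = 0) → ∀ m, E j 0 = ((j : ℝ) + 1) ^ m * E j m := by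
    intro j hj m
    induction m with
    | zero => simp
    | succ m ih => rw [ih, hrec j m, hj m]; ring
  have main : ∀ d j, j + d = κ → ∀ m, E j m = 0 := by
    intro d
    induction d with
    | zero =>
      intro j hj m
      obtain rfl : j = κ := by omega
      have := step j (fun m => big _ _ (by omega)) m
      rw [h0] at this
      have hp : ((j : ℝ) + 1) ^ m ≠ 0 := by positivity
      exact (mul_eq_zero.mp this.symm).resolve_left hp
    | succ d ih =>
      intro j hj m
      have hs := step j (ih (j + 1) (by omega))
      have hz : E j 0 = 0 := by
        have hr : ‖((j : ℝ) + 1) / ((κ : ℝ) + 1)‖ < 1 := by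
          rw [Real.norm_eq_abs, abs_of_nonneg (by positivity), div_lt_one (by positivity)]
          have : (j : ℝ) < κ := by exact_mod_cast (by omega : j < κ)
          linarith
        have hC : 0 ≤ C ∨ C < 0 := le_or_gt 0 C
        have ht := ((summable_choose_mul_geometric_of_norm_lt_one (d + 1) hr).tendsto_atTop_zero).const_mul C
        rw [mul_zero] at ht
        have ht2 := ht.comp (tendsto_add_atTop_nat (j + 1))
        have hle : ∀ n, |E j 0| ≤ ((fun n : ℕ => C * (((n + (d + 1)).choose (d + 1) : ℝ) *
            (((j : ℝ) + 1) / ((κ : ℝ) + 1)) ^ n)) ∘ fun n => n + (j + 1)) n := by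
          intro n
          have e1 : WE κ j n * ((j : ℝ) + 1) ^ (n + (j + 1)) =
            (((n + (j + 1)) + (d + 1)).choose (d + 1) : ℝ) *
            (((j : ℝ) + 1) / ((κ : ℝ) + 1)) ^ (n + (j + 1)) := by
            unfold WE
            rw [show κ + n + 1 = (n + (j + 1)) + (d + 1) by omega,
              show j + 1 + n = n + (j + 1) by omega, Nat.choose_symm_add, div_pow]
            ring
          simp only [Function.comp]
          rw [← e1, hs n, abs_mul, abs_of_nonneg (by positivity : (0 : ℝ) ≤ ((j : ℝ) + 1) ^ n)]
          have e2 : ((j : ℝ) + 1) ^ n ≤ ((j : ℝ) + 1) ^ (n + (j + 1)) :=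
            pow_le_pow_right₀ (by linarith [(Nat.cast_nonneg j : (0 : ℝ) ≤ j)]) (by omega)
          calc ((j : ℝ) + 1) ^ n * |E j n| ≤ ((j : ℝ) + 1) ^ (n + (j + 1)) * (C * WE κ j n) :=
                mul_le_mul e2 (hb j n) (abs_nonneg _) (by positivity)
            _ = _ := by ring
        have := ge_of_tendsto' ht2 hle
        exact abs_nonpos_iff.mp this
      have := hs m
      rw [hz] at this
      have hp : ((j : ℝ) + 1) ^ m ≠ 0 := by positivity
      exact (mul_eq_zero.mp this.symm).resolve_left hp
  intro j m
  rcases le_or_gt j κ with h | h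
  · exact main (κ - j) j (by omega) m
  · exact big j m h

theorem half_s8 (κ : ℕ) (t : ℝ) (V₁ V₂ : ℕ → ℕ → ℝ) (h1 : memV V₁) (h2 : memV V₂) (ht : 0 < t)
    (ht1 : t < 1)
    (h : ∀ n k : ℕ, Whatbucket κ n k = t * V₁ n k + (1 - t) * V₂ n k) : V₁ = Whatbucket κ := by
  obtain ⟨hz, hn, hone, hr⟩ := h1
  have hWn : WE κ κ 0 ≠ 0 := by
    unfold WE
    simp
    positivity
  have hrec : ∀ j m, V₁ (j + 1 + m) m =
      ((m : ℝ) + 1) * V₁ (j + 1 + 1 + m) m + ((j : ℝ) + 1) * V₁ (j + 1 + (m + 1)) (m + 1) := by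
    intro j m
    have := hr (j + 1 + m) m (by omega) (by omega)
    rw [this, show j + 1 + 1 + m = j + 1 + m + 1 by ring,
      show j + 1 + (m + 1) = j + 1 + m + 1 by ring]
    push_cast
    ring
  obtain ⟨c, hc⟩ : ∃ c, c = V₁ (κ + 1 + 0) 0 / WE κ κ 0 := ⟨_, rfl⟩
  have hc0 : 0 ≤ c := hc ▸ div_nonneg (hn _ _) (WE_nonneg _ _ _)
  have key := core κ (fun j m => V₁ (j + 1 + m) m - c * WE κ j m) (1 / t + c) (by
      intro j m
      rw [hrec j m, WE_rec κ j m]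
      ring) (by
      intro j m
      have hh := h (j + 1 + m) m
      rw [What_eq_WE] at hh
      have a1 := hn (j + 1 + m) m
      have a2 := mul_nonneg (by linarith : 0 ≤ 1 - t) (h2.2.1 (j + 1 + m) m)
      have a3 := mul_nonneg hc0 (WE_nonneg κ j m)
      have a4 : V₁ (j + 1 + m) m ≤ 1 / t * WE κ j m := by
        rw [one_div, inv_mul_eq_div, le_div_iff₀ ht]
        linarith
      rw [add_mul, abs_le]
      constructor <;> linarith) (by
      rw [hc, div_mul_cancel₀ _ hWn, sub_self])
  have hc1 : c = 1 := by
    have := key 0 0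
    simp only [WE] at this
    norm_num [hone] at this
    have hk : ((κ : ℝ) + 1) ≠ 0 := by positivity
    field_simp at this
    linarith
  funext n k
  by_cases hnk : 1 ≤ n ∧ k ≤ n - 1
  · obtain ⟨j, rfl⟩ : ∃ j, n = j + 1 + k := ⟨n - 1 - k, by omega⟩
    rw [What_eq_WE]
    have := key j k
    simp only [hc1] at this
    linarith
  · rw [hz n k (by omega)]
    unfold Whatbucket
    rw [if_neg hnk]

theorem stmt8 (κ : ℕ) :
    memV (Whatbucket κ) ∧
    (∀ (t : ℝ) (V₁ V₂ : ℕ → ℕ → ℝ), memV V₁ → memV V₂ → 0 < t → t < 1 →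
      (∀ n k : ℕ, Whatbucket κ n k = t * V₁ n k + (1 - t) * V₂ n k) →
      V₁ = Whatbucket κ ∧ V₂ = Whatbucket κ) := by
  refine ⟨⟨?_, ?_, ?_, ?_⟩, ?_⟩
  · intro n k hnk
    unfold Whatbucket
    rw [if_neg (by omega)]
  · intro n k
    unfold Whatbucket
    split_ifs
    · positivity
    · exact le_rfl
  · have hk : ((κ : ℝ) + 1) ≠ 0 := by positivity
    simp [Whatbucket, hk]
  · intro n k hn hk
    obtain ⟨j, rfl⟩ : ∃ j, n = j + 1 + k := ⟨n - 1 - k, by omega⟩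
    have e1 := What_eq_WE κ (j + 1) k
    have e2 := What_eq_WE κ j (k + 1)
    rw [show j + 1 + 1 + k = j + 1 + k + 1 by ring] at e1
    rw [show j + 1 + (k + 1) = j + 1 + k + 1 by ring] at e2
    rw [What_eq_WE, e1, e2, WE_rec]
    push_cast
    ring
  · intro t V₁ V₂ h1 h2 ht ht1 h
    refine ⟨half_s8 κ t V₁ V₂ h1 h2 ht ht1 h, half_s8 κ (1 - t) V₂ V₁ h2 h1 (by linarith) (by linarith) ?_⟩
    intro n k
    rw [h n k]
    ring
end

section
/- The function W^∞ belongs to 𝒱 and is an extreme point of 𝒱: if W^∞ = t·V₁ + (1−t)·V₂ with V₁, V₂ ∈ 𝒱 and 0 < t < 1, then V₁ = V₂ = W^∞. -/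
theorem scaled_rec {V : ℕ → ℕ → ℝ} (h : memV V) (n k : ℕ) (hk : k + 1 ≤ n) :
    ((n : ℝ) + 1) * (n.factorial * V n k) =
      ((k : ℝ) + 1) * ((n + 1).factorial * V (n + 1) k)
        + ((n : ℝ) - k) * ((n + 1).factorial * V (n + 1) (k + 1)) := by
  have h1 := h.2.2.2 n k (by omega) (by omega)
  rw [h1, Nat.factorial_succ]
  push_cast
  ring

theorem diff_bound {V : ℕ → ℕ → ℝ} (h : memV V) (C : ℝ)
    (hC : ∀ n k, (n.factorial : ℝ) * V n k ≤ C) (m : ℕ) :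
    ∀ n k : ℕ, k + 2 ≤ n →
      |(n.factorial : ℝ) * V n (k + 1) - n.factorial * V n k| * ((n : ℝ) + m) ≤ n * C := by
  induction m with
  | zero =>
    intro n k hk
    have a1 := hC n k
    have a2 := hC n (k + 1)
    have b1 : 0 ≤ (n.factorial : ℝ) * V n k := mul_nonneg (by positivity) (h.2.1 n k)
    have b2 : 0 ≤ (n.factorial : ℝ) * V n (k + 1) := mul_nonneg (by positivity) (h.2.1 n (k + 1))
    have : |(n.factorial : ℝ) * V n (k + 1) - n.factorial * V n k| ≤ C := by
      rw [abs_le]; constructor <;> linarith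
    have hn : (0 : ℝ) ≤ n := by positivity
    push_cast
    nlinarith
  | succ m ih =>
    intro n k hk
    have r1 := scaled_rec h n k (by omega)
    have r2 := scaled_rec h n (k + 1) (by omega)
    have i1 := ih (n + 1) k (by omega)
    have i2 := ih (n + 1) (k + 1) (by omega)
    have hkn : (k : ℝ) + 2 ≤ n := by exact_mod_cast hk
    have hk0 : (0 : ℝ) ≤ k := by positivity
    have hm0 : (0 : ℝ) ≤ m := by positivity
    push_cast at r2 i1 i2 ⊢
    generalize (n.factorial : ℝ) * V n k = a at *
    generalize (n.factorial : ℝ) * V n (k + 1) = b at *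
    generalize ((n + 1).factorial : ℝ) * V (n + 1) k = x at *
    generalize ((n + 1).factorial : ℝ) * V (n + 1) (k + 1) = y at *
    generalize ((n + 1).factorial : ℝ) * V (n + 1) (k + 1 + 1) = z at *
    have e : ((n : ℝ) + 1) * (b - a) = ((k : ℝ) + 1) * (y - x) + ((n : ℝ) - k - 1) * (z - y) := by
      linear_combination r2 - r1
    have e2 : ((n : ℝ) + 1) * |b - a| ≤ ((k : ℝ) + 1) * |y - x| + ((n : ℝ) - k - 1) * |z - y| := by
      have : |((n : ℝ) + 1) * (b - a)| = ((n : ℝ) + 1) * |b - a| := by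
        rw [abs_mul, abs_of_nonneg (by linarith)]
      rw [← this, e]
      refine (abs_add_le _ _).trans ?_
      rw [abs_mul, abs_mul, abs_of_nonneg (by linarith : (0 : ℝ) ≤ k + 1),
        abs_of_nonneg (by linarith : (0 : ℝ) ≤ (n : ℝ) - k - 1)]
    have e3 := mul_le_mul_of_nonneg_right e2 (by linarith : (0 : ℝ) ≤ (n : ℝ) + 1 + m)
    have j1 := mul_le_mul_of_nonneg_left i1 (by linarith : (0 : ℝ) ≤ (k : ℝ) + 1)
    have j2 := mul_le_mul_of_nonneg_left i2 (by linarith : (0 : ℝ) ≤ (n : ℝ) - k - 1)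
    refine le_of_mul_le_mul_left ?_ (by linarith : (0 : ℝ) < (n : ℝ) + 1)
    linarith

theorem diff_zero {V : ℕ → ℕ → ℝ} (h : memV V) (C : ℝ)
    (hC : ∀ n k, (n.factorial : ℝ) * V n k ≤ C) (n k : ℕ) (hk : k + 2 ≤ n) :
    (n.factorial : ℝ) * V n (k + 1) = n.factorial * V n k := by
  by_contra hne
  have hpos : 0 < |(n.factorial : ℝ) * V n (k + 1) - n.factorial * V n k| :=
    abs_pos.mpr (sub_ne_zero.mpr hne)
  obtain ⟨m, hm⟩ := exists_nat_gt (n * C / |(n.factorial : ℝ) * V n (k + 1) - n.factorial * V n k|)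
  have h1 := diff_bound h C hC m n k hk
  rw [div_lt_iff₀ hpos] at hm
  have : (0 : ℝ) ≤ n := by positivity
  nlinarith

theorem scaled_one {V : ℕ → ℕ → ℝ} (h : memV V) (C : ℝ)
    (hC : ∀ n k, (n.factorial : ℝ) * V n k ≤ C) (n : ℕ) :
    ∀ k, k ≤ n → ((n + 1).factorial : ℝ) * V (n + 1) k = 1 := by
  induction n with
  | zero =>
    intro k hk
    obtain rfl : k = 0 := by omega
    simp [h.2.2.1]
  | succ n ih =>
    have h0 : ((n + 1 + 1).factorial : ℝ) * V (n + 1 + 1) 0 = 1 := by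
      have r := scaled_rec h (n + 1) 0 (by omega)
      rw [diff_zero h C hC (n + 1 + 1) 0 (by omega), ih 0 (by omega)] at r
      push_cast at r ⊢
      have hn : (0 : ℝ) < (n : ℝ) + 1 + 1 := by positivity
      refine mul_left_cancel₀ hn.ne' ?_
      linarith
    intro k
    induction k with
    | zero => intro _; exact h0
    | succ k ihk =>
      intro hk
      rw [diff_zero h C hC (n + 1 + 1) k (by omega)]
      exact ihk (by omega)

theorem eq_Winf {V : ℕ → ℕ → ℝ} (h : memV V) (C : ℝ)
    (hC : ∀ n k, (n.factorial : ℝ) * V n k ≤ C) : V = Winf := by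
  funext n k
  unfold Winf
  split_ifs with hh
  · obtain ⟨n, rfl⟩ : ∃ m, n = m + 1 := ⟨n - 1, by omega⟩
    have := scaled_one h C hC n k (by omega)
    rw [eq_div_iff (by positivity)]
    linarith
  · exact h.1 n k (by omega)

theorem Winf_le (n k : ℕ) : (n.factorial : ℝ) * Winf n k ≤ 1 := by
  unfold Winf
  split_ifs
  · rw [mul_one_div_cancel (by positivity)]
  · simp

theorem memV_Winf : memV Winf := by
  refine ⟨?_, ?_, ?_, ?_⟩
  · intro n k h
    unfold Winf
    rw [if_neg (by omega)]
  · intro n k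
    unfold Winf
    split_ifs <;> positivity
  · simp [Winf]
  · intro n k hn hk
    unfold Winf
    rw [if_pos (by omega), if_pos (by omega), if_pos (by omega), Nat.factorial_succ]
    push_cast
    field_simp
    ring

theorem bound_of_mix {t : ℝ} {V₁ V₂ : ℕ → ℕ → ℝ} (h₂ : memV V₂) (ht : 0 < t) (ht1 : t < 1)
    (h : ∀ n k : ℕ, Winf n k = t * V₁ n k + (1 - t) * V₂ n k) (n k : ℕ) :
    (n.factorial : ℝ) * V₁ n k ≤ 1 / t := by
  have h1 := Winf_le n k
  rw [h n k] at h1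
  have h2 : 0 ≤ (n.factorial : ℝ) * ((1 - t) * V₂ n k) :=
    mul_nonneg (by positivity) (mul_nonneg (by linarith) (h₂.2.1 n k))
  rw [le_div_iff₀ ht]
  linarith

theorem stmt9 :
    memV Winf ∧
    (∀ (t : ℝ) (V₁ V₂ : ℕ → ℕ → ℝ), memV V₁ → memV V₂ → 0 < t → t < 1 →
      (∀ n k : ℕ, Winf n k = t * V₁ n k + (1 - t) * V₂ n k) →
      V₁ = Winf ∧ V₂ = Winf) := by
  refine ⟨memV_Winf, ?_⟩
  intro t V₁ V₂ h₁ h₂ ht ht1 h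
  refine ⟨eq_Winf h₁ _ (bound_of_mix h₂ ht ht1 h), 
    eq_Winf h₂ (1 / (1 - t)) (bound_of_mix (t := 1 - t) h₁ (by linarith) (by linarith) ?_)⟩
  intro n k
  rw [h n k]
  ring
end

section
/- The map W ↦ W 2 0 is a bijection from the set of extreme points of 𝒱 onto the set Θ = { κ/(2(κ+1)) : κ ∈ ℕ } ∪ { 1/2 } ∪ { (κ+2)/(2(κ+1)) : κ ∈ ℕ } ⊆ ℝ; in particular every extreme point W of 𝒱 is uniquely determined by the value W 2 0, which lies in Θ. -/
/-- `W` is an extreme point of `𝒱`. -/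
def ExtremePt (W : ℕ → ℕ → ℝ) : Prop :=
  memV W ∧ ∀ (t : ℝ) (V₁ V₂ : ℕ → ℕ → ℝ), memV V₁ → memV V₂ → 0 < t → t < 1 →
    (∀ n k : ℕ, W n k = t * V₁ n k + (1 - t) * V₂ n k) → V₁ = W ∧ V₂ = W

/-- The parameter set `Θ`. -/
def Theta : Set ℝ :=
  {x | ∃ κ : ℕ, x = (κ : ℝ) / (2 * ((κ : ℝ) + 1))} ∪ {1 / 2} ∪
    {x | ∃ κ : ℕ, x = ((κ : ℝ) + 2) / (2 * ((κ : ℝ) + 1))}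

/-- The cone of nonnegative solutions to the recursion, without normalization. -/
def coneV (V : ℕ → ℕ → ℝ) : Prop :=
  (∀ n k : ℕ, n = 0 ∨ n ≤ k → V n k = 0) ∧
  (∀ n k : ℕ, 0 ≤ V n k) ∧
  (∀ n k : ℕ, k < n →
    V n k = ((k : ℝ) + 1) * V (n + 1) k + ((n : ℝ) - (k : ℝ)) * V (n + 1) (k + 1))

/-- Multiplication by `(1+u)/2`. -/
noncomputable def opT (V : ℕ → ℕ → ℝ) : ℕ → ℕ → ℝ := fun n k =>
  if n = 0 ∨ n ≤ k then 0 else (V n k + V (n + 1) k - V (n + 1) (k + 1)) / 2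

lemma memV_cone {V : ℕ → ℕ → ℝ} (h : memV V) : coneV V :=
  ⟨h.1, h.2.1, fun n k hk => h.2.2.2 n k (by omega) (by omega)⟩

lemma cone_memV {V : ℕ → ℕ → ℝ} (h : coneV V) (h1 : V 1 0 = 1) : memV V :=
  ⟨h.1, h.2.1, h1, fun n k hn hk => h.2.2 n k (by omega)⟩

lemma opT_of_lt (V : ℕ → ℕ → ℝ) {n k : ℕ} (h : k < n) :
    opT V n k = (V n k + V (n + 1) k - V (n + 1) (k + 1)) / 2 := by
  have : ¬ (n = 0 ∨ n ≤ k) := by omega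
  simp [opT, this]

lemma opT_of_ge (V : ℕ → ℕ → ℝ) {n k : ℕ} (h : n = 0 ∨ n ≤ k) : opT V n k = 0 := by
  simp [opT, h]

lemma cone_opT {V : ℕ → ℕ → ℝ} (h : coneV V) : coneV (opT V) := by
  refine ⟨fun n k hk => opT_of_ge V hk, fun n k => ?_, fun n k hk => ?_⟩
  · by_cases hk : k < n
    · rw [opT_of_lt V hk, h.2.2 n k hk]
      have h1 := h.2.1 (n+1) k
      have h2 := h.2.1 (n+1) (k+1)
      have h3 : (k:ℝ) + 1 ≤ n := by exact_mod_cast hk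
      have h4 : 0 ≤ ((k:ℝ) + 2) * V (n+1) k := by positivity
      have h5 : 0 ≤ ((n:ℝ) - k - 1) * V (n+1) (k+1) := mul_nonneg (by linarith) h2
      linarith
    · rw [opT_of_ge V (by omega)]
  · rw [opT_of_lt V hk, opT_of_lt V (by omega), opT_of_lt V (by omega),
      h.2.2 n k hk, h.2.2 (n+1) k (by omega), h.2.2 (n+1) (k+1) (by omega)]
    push_cast
    ring

lemma cone_opT' {V : ℕ → ℕ → ℝ} (h : coneV V) : coneV (fun n k => V n k - opT V n k) := by
  have hT := cone_opT h
  refine ⟨fun n k hk => ?_, fun n k => ?_, fun n k hk => ?_⟩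
  · simp only
    rw [h.1 n k hk, hT.1 n k hk, sub_zero]
  · by_cases hk : k < n
    · simp only
      rw [opT_of_lt V hk, h.2.2 n k hk]
      have h1 := h.2.1 (n+1) k
      have h2 := h.2.1 (n+1) (k+1)
      have h3 : (k:ℝ) + 1 ≤ n := by exact_mod_cast hk
      have h4 : 0 ≤ (k:ℝ) * V (n+1) k := by positivity
      have h5 : 0 ≤ ((n:ℝ) - k + 1) * V (n+1) (k+1) := mul_nonneg (by linarith) h2
      linarith
    · simp only
      rw [opT_of_ge V (by omega), h.1 n k (by omega), sub_zero]
  · have e1 := h.2.2 n k hk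
    have e2 := hT.2.2 n k hk
    simp only
    linear_combination e1 - e2

lemma opT_sub (V U : ℕ → ℕ → ℝ) (n k : ℕ) :
    opT (fun n k => V n k - U n k) n k = opT V n k - opT U n k := by
  unfold opT
  split_ifs <;> ring

lemma opT_comb (V U : ℕ → ℕ → ℝ) (s t : ℝ) (n k : ℕ) :
    opT (fun n k => s * V n k + t * U n k) n k = s * opT V n k + t * opT U n k := by
  unfold opT
  split_ifs <;> ring

/-- Second moments of Bernstein weights are nonnegative. -/
lemma bern (N : ℕ) : ∀ (V : ℕ → ℕ → ℝ) (c : ℝ), coneV V → ∀ n k : ℕ,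
    0 ≤ (N:ℝ)^2 * opT (opT V) n k - 2 * N * c * opT V n k + c^2 * V n k
      + N * (opT V n k - opT (opT V) n k) := by
  induction N with
  | zero =>
    intro V c h n k
    have := h.2.1 n k
    simp
    positivity
  | succ N ih =>
    intro V c h n k
    have h1 := ih (opT V) (c - 1) (cone_opT h) n k
    have h2 := ih _ c (cone_opT' h) n k
    have e : opT (fun n k => V n k - opT V n k) = fun n k => opT V n k - opT (opT V) n k := by
      funext n k
      exact opT_sub V (opT V) n k
    rw [e, opT_sub] at h2
    push_cast
    nlinarith [h1, h2]

lemma sq_nonneg_op {V : ℕ → ℕ → ℝ} (h : coneV V) (x : ℝ) (n k : ℕ) :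
    0 ≤ opT (opT V) n k - 2 * x * opT V n k + x^2 * V n k := by
  by_contra! hneg
  set A := opT (opT V) n k - 2 * x * opT V n k + x^2 * V n k with hA
  set B := opT V n k - opT (opT V) n k with hB
  obtain ⟨N, hN⟩ := exists_nat_gt (B / (-A))
  have hB0 : 0 ≤ B := by
    have := (cone_opT' (cone_opT h)).2.1 n k
    exact this
  have hN' : B < N * (-A) := by rwa [div_lt_iff₀ (by linarith)] at hN
  have hNpos : (0:ℝ) < N := by
    by_contra! h0
    have : (N:ℝ) * (-A) ≤ 0 := mul_nonpos_of_nonpos_of_nonneg h0 (by linarith)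
    linarith
  have hb := bern N V (N * x) h n k
  have : (N:ℝ)^2 * opT (opT V) n k - 2 * N * (N * x) * opT V n k + (N * x)^2 * V n k
      + N * (opT V n k - opT (opT V) n k) = N * (N * A + B) := by
    rw [hA, hB]; ring
  rw [this] at hb
  have := mul_pos hNpos (show 0 < -(N * A + B) by linarith)
  linarith

lemma cone_zero {V : ℕ → ℕ → ℝ} (h : coneV V) (h0 : V 1 0 = 0) : ∀ n k, V n k = 0 := by
  have key : ∀ n k, V (n+1) k = 0 := by
    intro n
    induction n with
    | zero =>
      intro k
      rcases Nat.eq_zero_or_pos k with rfl | hk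
      · exact h0
      · exact h.1 _ _ (by omega)
    | succ n ih =>
      have both : ∀ k, k < n + 1 → V (n+2) k = 0 ∧ V (n+2) (k+1) = 0 := by
        intro k hk
        have e := h.2.2 (n+1) k hk
        rw [ih k] at e
        have h1 := h.2.1 (n+2) k
        have h2 := h.2.1 (n+2) (k+1)
        have h3 : (k:ℝ) + 1 ≤ ((n+1 : ℕ):ℝ) := by exact_mod_cast hk
        have h4 : 0 ≤ ((k:ℝ)) * V (n+2) k := by positivity
        have h5 : 0 ≤ (((n+1:ℕ):ℝ) - k - 1) * V (n+2) (k+1) := mul_nonneg (by linarith) h2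
        have e' : 0 = ((k : ℝ) + 1) * V (n + 2) k
          + (((n+1:ℕ) : ℝ) - (k : ℝ)) * V (n + 2) (k + 1) := e
        constructor <;> linarith
      intro k
      rcases Nat.lt_or_ge k (n+1) with hk | hk
      · exact (both k hk).1
      · rcases Nat.eq_or_lt_of_le hk with hk | hk
        · subst hk
          exact (both n (by omega)).2
        · exact h.1 _ _ (by omega)
  intro n k
  cases n with
  | zero => exact h.1 _ _ (by omega)
  | succ n => exact key n k

lemma step {V : ℕ → ℕ → ℝ} (h : coneV V) {x : ℝ} (hx : ∀ n k, opT V n k = x * V n k)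
    {n k : ℕ} (hk : k < n) :
    ((n:ℝ) + 1) * V (n+1) k = (1 + ((n:ℝ) - k) * (2 * x - 1)) * V n k ∧
    ((n:ℝ) + 1) * V (n+1) (k+1) = (1 - ((k:ℝ) + 1) * (2 * x - 1)) * V n k := by
  have e1 := hx n k
  rw [opT_of_lt V hk] at e1
  have e2 := h.2.2 n k hk
  constructor
  · linear_combination (2 * ((n:ℝ) - k)) * e1 - e2
  · linear_combination (-2 * ((k:ℝ) + 1)) * e1 - e2

lemma eigen_unique {V U : ℕ → ℕ → ℝ} (hV : memV V) (hU : memV U) {x : ℝ}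
    (hVx : ∀ n k, opT V n k = x * V n k) (hUx : ∀ n k, opT U n k = x * U n k) : V = U := by
  have key : ∀ n k, V (n+1) k = U (n+1) k := by
    intro n
    induction n with
    | zero =>
      intro k
      rcases Nat.eq_zero_or_pos k with rfl | hk
      · rw [hV.2.2.1, hU.2.2.1]
      · rw [hV.1 _ _ (by omega), hU.1 _ _ (by omega)]
    | succ n ih =>
      have both : ∀ k, k < n + 1 → V (n+2) k = U (n+2) k ∧ V (n+2) (k+1) = U (n+2) (k+1) := by
        intro k hk
        have a := step (memV_cone hV) hVx hk
        have b := step (memV_cone hU) hUx hk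
        rw [ih k, ← b.1, ← b.2] at a
        have hp : (((n+1:ℕ):ℝ) + 1) ≠ 0 := by positivity
        exact ⟨mul_left_cancel₀ hp a.1, mul_left_cancel₀ hp a.2⟩
      intro k
      rcases Nat.lt_or_ge k (n+1) with hk | hk
      · exact (both k hk).1
      · rcases Nat.eq_or_lt_of_le hk with hk | hk
        · subst hk
          exact (both n (by omega)).2
        · rw [hV.1 _ _ (by omega), hU.1 _ _ (by omega)]
  funext n k
  cases n with
  | zero => rw [hV.1 _ _ (by omega), hU.1 _ _ (by omega)]
  | succ n => exact key n k

lemma opT_one {V : ℕ → ℕ → ℝ} (h : coneV V) : opT V 1 0 = V 2 0 := by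
  have e := h.2.2 1 0 (by omega)
  rw [opT_of_lt V (by omega), e]
  norm_num
  ring

lemma extreme_eigen {W : ℕ → ℕ → ℝ} (h : ExtremePt W) :
    ∀ n k, opT W n k = W 2 0 * W n k := by
  obtain ⟨hW, hext⟩ := h
  have hc := memV_cone hW
  have hT := cone_opT hc
  have hT' := cone_opT' hc
  have e1 := opT_one hc
  have hW1 := hW.2.2.1
  have n0 : 0 ≤ W 2 0 := hW.2.1 2 0
  have n1 : 0 ≤ 1 - W 2 0 := by
    have := hT'.2.1 1 0
    simp only [e1, hW1] at this
    exact this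
  rcases n0.eq_or_lt with h0 | h0
  · intro n k
    rw [← h0, zero_mul]
    exact cone_zero hT (by rw [e1, ← h0]) n k
  rcases n1.eq_or_lt with h1 | h1
  · intro n k
    have := cone_zero hT' (by simp only [e1, hW1]; exact h1.symm) n k
    try simp only at this
    have h2 : W 2 0 = 1 := by linarith
    rw [h2]; linarith
  set x := W 2 0 with hx
  have m1 : memV (fun n k => x⁻¹ * opT W n k) := by
    refine ⟨fun n k hk => ?_, fun n k => ?_, ?_, fun n k hn hk => ?_⟩
    · simp only [hT.1 n k hk, mul_zero]
    · exact mul_nonneg (by positivity) (hT.2.1 n k)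
    · simp only [e1]; exact inv_mul_cancel₀ h0.ne'
    · have := hT.2.2 n k (by omega)
      simp only
      linear_combination x⁻¹ * this
  have m2 : memV (fun n k => (1-x)⁻¹ * (W n k - opT W n k)) := by
    refine ⟨fun n k hk => ?_, fun n k => ?_, ?_, fun n k hn hk => ?_⟩
    · have := hT'.1 n k hk
      simp only at this ⊢
      rw [this, mul_zero]
    · exact mul_nonneg (by positivity) (hT'.2.1 n k)
    · simp only [e1, hW1]; exact inv_mul_cancel₀ h1.ne'
    · have := hT'.2.2 n k (by omega)
      simp only at this ⊢
      linear_combination (1-x)⁻¹ * this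
  have := (hext x _ _ m1 m2 h0 (by linarith) (fun n k => by
    try simp only
    rw [mul_inv_cancel_left₀ h0.ne', mul_inv_cancel_left₀ h1.ne']
    ring)).1
  intro n k
  have e := congrFun (congrFun this n) k
  try simp only at e
  rw [← e, mul_inv_cancel_left₀ h0.ne']

lemma eigen_extreme {W : ℕ → ℕ → ℝ} (hW : memV W) {x : ℝ}
    (hx : ∀ n k, opT W n k = x * W n k) : ExtremePt W := by
  refine ⟨hW, fun t V₁ V₂ h1 h2 t0 t1 hcomb => ?_⟩
  have c1 := memV_cone h1
  have c2 := memV_cone h2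
  have hfun : W = fun n k => t * V₁ n k + (1 - t) * V₂ n k := by
    funext n k; exact hcomb n k
  have hT : opT W = fun n k => t * opT V₁ n k + (1 - t) * opT V₂ n k := by
    funext n k
    rw [hfun]; exact opT_comb _ _ _ _ n k
  have hTT : ∀ n k, opT (opT W) n k = t * opT (opT V₁) n k + (1 - t) * opT (opT V₂) n k := by
    intro n k
    rw [hT]; exact opT_comb _ _ _ _ n k
  have hTx : opT W = fun n k => x * W n k + 0 * W n k := by
    funext n k; rw [hx]; ring
  have hTTx : ∀ n k, opT (opT W) n k = x * (x * W n k) := by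
    intro n k
    rw [hTx, opT_comb, hx]; ring
  have zero : ∀ n k, (opT (opT V₁) n k - 2 * x * opT V₁ n k + x^2 * V₁ n k = 0) ∧
      (opT (opT V₂) n k - 2 * x * opT V₂ n k + x^2 * V₂ n k = 0) := by
    intro n k
    have p1 := sq_nonneg_op c1 x n k
    have p2 := sq_nonneg_op c2 x n k
    have s : t * (opT (opT V₁) n k - 2 * x * opT V₁ n k + x^2 * V₁ n k) +
        (1 - t) * (opT (opT V₂) n k - 2 * x * opT V₂ n k + x^2 * V₂ n k) = 0 := by
      have a := hTT n k
      have b := congrFun (congrFun hT n) k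
      try simp only at b
      have c := hcomb n k
      have d := hTTx n k
      have e := hx n k
      linear_combination (-1) * a + 2 * x * b - x^2 * c + d - 2 * x * e
    have q1 := mul_nonneg t0.le p1
    have q2 := mul_nonneg (sub_pos.2 t1).le p2
    constructor
    · have : t * (opT (opT V₁) n k - 2 * x * opT V₁ n k + x^2 * V₁ n k) = 0 := by linarith
      exact (mul_eq_zero.1 this).resolve_left t0.ne'
    · have : (1 - t) * (opT (opT V₂) n k - 2 * x * opT V₂ n k + x^2 * V₂ n k) = 0 := by linarith
      exact (mul_eq_zero.1 this).resolve_left (sub_pos.2 t1).ne'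
  have eig : ∀ V : ℕ → ℕ → ℝ, coneV V →
      (∀ n k, opT (opT V) n k - 2 * x * opT V n k + x^2 * V n k = 0) →
      ∀ n k, opT V n k = x * V n k := by
    intro V hV hz n k
    have z := hz n k
    have c0 := hV.2.1 n k
    set A := opT (opT V) n k
    set B := opT V n k
    set C := V n k
    set D := B - x * C with hD
    have q : ∀ d : ℝ, 0 ≤ -2 * d * D + d^2 * C := by
      intro d
      have := sq_nonneg_op hV (x + d) n k
      nlinarith
    have hp : 0 < C + 1 := by linarith
    have qq := q (D / (C + 1))
    have : -2 * (D / (C+1)) * D + (D / (C+1))^2 * C = - (D^2 * (C + 2)) / (C+1)^2 := by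
      field_simp
      ring
    rw [this] at qq
    have h3 : 0 ≤ -(D^2 * (C+2)) := by
      by_contra! hlt
      have := div_neg_of_neg_of_pos hlt (show 0 < (C+1)^2 by positivity)
      linarith
    have hD0 : D = 0 := by
      have : D^2 ≤ 0 := by nlinarith [sq_nonneg D, mul_nonneg (sq_nonneg D) c0]
      exact pow_eq_zero_iff (two_ne_zero) |>.1 (le_antisymm this (sq_nonneg D))
    linarith
  exact ⟨eigen_unique h1 hW (eig V₁ c1 fun n k => (zero n k).1) hx,
    eigen_unique h2 hW (eig V₂ c2 fun n k => (zero n k).2) hx⟩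

/-- The explicit extreme points. -/
noncomputable def Qf (u : ℝ) : ℕ → ℕ → ℝ := fun n k =>
  if n = 0 ∨ n ≤ k then 0 else
    (∏ i ∈ Finset.range n, (1 + ((i:ℝ) - k) * u)) / (n.factorial : ℝ)

lemma Qf_of_lt (u : ℝ) {n k : ℕ} (h : k < n) :
    Qf u n k = (∏ i ∈ Finset.range n, (1 + ((i:ℝ) - k) * u)) / (n.factorial : ℝ) := by
  have : ¬ (n = 0 ∨ n ≤ k) := by omega
  simp only [Qf, this, if_false]

lemma Qf_of_ge (u : ℝ) {n k : ℕ} (h : n = 0 ∨ n ≤ k) : Qf u n k = 0 := by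
  simp only [Qf, h, if_true]

lemma Qf_step (u : ℝ) {n k : ℕ} (hk : k < n) :
    Qf u (n+1) k = (1 + ((n:ℝ) - k) * u) * Qf u n k / ((n:ℝ) + 1) ∧
    Qf u (n+1) (k+1) = (1 - ((k:ℝ) + 1) * u) * Qf u n k / ((n:ℝ) + 1) := by
  have hf : (n.factorial : ℝ) ≠ 0 := by exact_mod_cast n.factorial_ne_zero
  have hn : (n:ℝ) + 1 ≠ 0 := by positivity
  rw [Qf_of_lt u hk, Qf_of_lt u (by omega), Qf_of_lt u (by omega), Nat.factorial_succ]
  constructor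
  · rw [Finset.prod_range_succ]
    generalize ∏ i ∈ Finset.range n, (1 + ((i:ℝ) - k) * u) = P
    push_cast
    field_simp
  · rw [Finset.prod_range_succ']
    have : ∏ i ∈ Finset.range n, (1 + (((i+1:ℕ):ℝ) - ((k+1:ℕ):ℝ)) * u)
        = ∏ i ∈ Finset.range n, (1 + ((i:ℝ) - k) * u) := by
      refine Finset.prod_congr rfl fun i _ => ?_
      push_cast; ring
    rw [this]
    generalize ∏ i ∈ Finset.range n, (1 + ((i:ℝ) - k) * u) = P
    push_cast
    field_simp
    ring

lemma Qf_mem {u : ℝ} (hu : ∀ n k : ℕ, k < n →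
    0 ≤ ∏ i ∈ Finset.range n, (1 + ((i:ℝ) - k) * u)) : memV (Qf u) := by
  refine ⟨fun n k hk => Qf_of_ge u hk, fun n k => ?_, ?_, fun n k hn hk => ?_⟩
  · by_cases hk : k < n
    · rw [Qf_of_lt u hk]
      exact div_nonneg (hu n k hk) (by positivity)
    · rw [Qf_of_ge u (by omega)]
  · rw [Qf_of_lt u (by omega)]; simp
  · have s := Qf_step u (show k < n by omega)
    have hn : (n:ℝ) + 1 ≠ 0 := by positivity
    rw [s.1, s.2]
    field_simp
    ring

lemma Qf_eigen (u : ℝ) (n k : ℕ) : opT (Qf u) n k = (1 + u) / 2 * Qf u n k := by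
  by_cases hk : k < n
  · have s := Qf_step u hk
    have hn : (n:ℝ) + 1 ≠ 0 := by positivity
    rw [opT_of_lt _ hk, s.1, s.2]
    field_simp
    ring
  · rw [opT_of_ge _ (by omega), Qf_of_ge u (by omega), mul_zero]

lemma Qf_two (u : ℝ) : Qf u 2 0 = (1 + u) / 2 := by
  rw [Qf_of_lt u (by omega)]
  simp [Finset.prod_range_succ]

lemma Qf_extreme {u : ℝ} (hu : ∀ n k : ℕ, k < n →
    0 ≤ ∏ i ∈ Finset.range n, (1 + ((i:ℝ) - k) * u)) : ExtremePt (Qf u) :=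
  eigen_extreme (Qf_mem hu) (Qf_eigen u)

lemma pos_case (κ n k : ℕ) (hk : k < n) :
    0 ≤ ∏ i ∈ Finset.range n, (1 + ((i:ℝ) - k) * (1 / ((κ:ℝ) + 1))) := by
  have hp : (0:ℝ) < (κ:ℝ) + 1 := by positivity
  by_cases h : κ + 1 ≤ k
  · apply le_of_eq
    symm
    apply Finset.prod_eq_zero (i := k - (κ + 1)) (Finset.mem_range.2 (by omega))
    rw [Nat.cast_sub h]
    push_cast
    field_simp
    ring
  · refine Finset.prod_nonneg fun i _ => ?_
    have h1 : (k:ℝ) ≤ κ := by exact_mod_cast (by omega : k ≤ κ)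
    have h2 : (0:ℝ) ≤ i := by positivity
    have : 1 + ((i:ℝ) - k) * (1 / ((κ:ℝ) + 1)) = ((κ:ℝ) + 1 + i - k) / ((κ:ℝ) + 1) := by
      field_simp
      ring
    rw [this]
    exact div_nonneg (by linarith) hp.le

lemma neg_case (κ n k : ℕ) :
    0 ≤ ∏ i ∈ Finset.range n, (1 + ((i:ℝ) - k) * (-1 / ((κ:ℝ) + 1))) := by
  have hp : (0:ℝ) < (κ:ℝ) + 1 := by positivity
  by_cases h : κ + 1 + k < n
  · apply le_of_eq
    symm
    apply Finset.prod_eq_zero (i := κ + 1 + k) (Finset.mem_range.2 h)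
    push_cast
    field_simp
    ring
  · refine Finset.prod_nonneg fun i hi => ?_
    have hi := Finset.mem_range.1 hi
    have h1 : (i:ℝ) ≤ κ + 1 + k := by exact_mod_cast (by omega : i ≤ κ + 1 + k)
    have : 1 + ((i:ℝ) - k) * (-1 / ((κ:ℝ) + 1)) = ((κ:ℝ) + 1 + k - i) / ((κ:ℝ) + 1) := by
      field_simp
      ring
    rw [this]
    exact div_nonneg (by linarith) hp.le

/-- If all partial products of `1 - i v` are nonnegative and `v > 0`, then `v = 1/(κ+1)`. -/
lemma recip_of_seq {v : ℝ} (hv : 0 < v) (a : ℕ → ℝ) (h0 : a 0 = 1) (ha : ∀ n, 0 ≤ a n)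
    (hs : ∀ n : ℕ, ((n:ℝ) + 2) * a (n+1) = (1 - ((n:ℝ) + 1) * v) * a n) :
    ∃ κ : ℕ, ((κ:ℝ) + 1) * v = 1 := by
  by_contra! hne
  have hpos : ∀ n, 0 < a n := by
    intro n
    induction n with
    | zero => rw [h0]; norm_num
    | succ n ih =>
      rcases (ha (n+1)).eq_or_lt with h | h
      · exfalso
        have e := hs n
        rw [← h, mul_zero] at e
        rcases mul_eq_zero.1 e.symm with h2 | h2
        · exact hne n (by linarith)
        · linarith
      · exact h
  obtain ⟨N, hN⟩ := exists_nat_gt (1 / v)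
  rw [div_lt_iff₀ hv] at hN
  have e := hs N
  have p1 : 0 < ((N:ℝ) + 2) * a (N+1) := mul_pos (by positivity) (hpos _)
  have p2 : (1 - ((N:ℝ) + 1) * v) * a N < 0 :=
    mul_neg_of_neg_of_pos (by nlinarith) (hpos N)
  linarith

lemma extreme_theta {W : ℕ → ℕ → ℝ} (h : ExtremePt W) : W 2 0 ∈ Theta := by
  have hx := extreme_eigen h
  have hW := h.1
  have hc := memV_cone hW
  set x := W 2 0 with hxd
  rcases lt_trichotomy (2 * x - 1) 0 with hu | hu | hu
  · obtain ⟨κ, hκ⟩ := recip_of_seq (v := -(2 * x - 1)) (by linarith) (fun n => W (n+1) 0)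
      hW.2.2.1 (fun n => hW.2.1 _ _) (fun n => by
        have s := (step hc hx (show 0 < n + 1 by omega)).1
        push_cast at s
        linear_combination s)
    refine Or.inl (Or.inl ⟨κ, ?_⟩)
    have hp : (κ:ℝ) + 1 ≠ 0 := by positivity
    field_simp
    linarith
  · exact Or.inl (Or.inr (by simp only [Set.mem_singleton_iff]; linarith))
  · obtain ⟨κ, hκ⟩ := recip_of_seq (v := 2 * x - 1) hu (fun n => W (n+1) n)
      hW.2.2.1 (fun n => hW.2.1 _ _) (fun n => by
        have s := (step hc hx (show n < n + 1 by omega)).2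
        push_cast at s
        linear_combination s)
    refine Or.inr ⟨κ, ?_⟩
    have hp : (κ:ℝ) + 1 ≠ 0 := by positivity
    field_simp
    linarith

theorem stmt11 :
    Set.BijOn (fun W : ℕ → ℕ → ℝ => W 2 0) {W | ExtremePt W} Theta := by
  refine ⟨fun W hW => extreme_theta hW, fun W hW U hU hWU => ?_, ?_⟩
  · have a := extreme_eigen hW
    have b := extreme_eigen hU
    simp only at hWU
    rw [← hWU] at b
    exact eigen_unique hW.1 hU.1 a b
  · rintro x ((⟨κ, rfl⟩ | hx) | ⟨κ, rfl⟩)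
    · refine ⟨Qf (-1 / ((κ:ℝ) + 1)), Qf_extreme fun n k _ => neg_case κ n k, ?_⟩
      have hp : (κ:ℝ) + 1 ≠ 0 := by positivity
      simp only [Qf_two]
      field_simp
      ring
    · rw [Set.mem_singleton_iff] at hx
      subst hx
      refine ⟨Qf 0, Qf_extreme fun n k _ => by simp, ?_⟩
      simp only [Qf_two]
      norm_num
    · refine ⟨Qf (1 / ((κ:ℝ) + 1)), Qf_extreme fun n k hk => pos_case κ n k hk, ?_⟩
      have hp : (κ:ℝ) + 1 ≠ 0 := by positivity
      simp only [Qf_two]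
      field_simp
      ring
end

section
/- For every V ∈ 𝒱 there exist unique nonnegative functions p, q : ℕ → ℝ and a unique nonnegative real r, with (∑_{κ} p(κ)) + (∑_{κ} q(κ)) + r = 1 (both series convergent), such that for all n, k: V n k = ∑_{κ} p(κ)·W^κ n k + ∑_{κ} q(κ)·Ŵ^κ n k + r·W^∞ n k (all series absolutely convergent). -/
/-- The polynomial array `F n k t = (1/n!) ∏_{j=-k}^{n-1-k} (1 + j t)`. -/
noncomputable def eF (n k : ℕ) (t : ℝ) : ℝ :=
  if 1 ≤ n ∧ k ≤ n - 1 then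
    (∏ i ∈ Finset.range n, (1 + ((i : ℝ) - (k : ℝ)) * t)) / (Nat.factorial n : ℝ) else 0

theorem eF_W (κ n k : ℕ) : eF n k (1 / ((κ : ℝ) + 1)) = Wbucket κ n k := by
  unfold eF Wbucket
  split_ifs with h
  swap; · rfl
  have hκ : ((κ : ℝ) + 1) ≠ 0 := by positivity
  have hn : (Nat.factorial n : ℝ) ≠ 0 := by positivity
  have h1 : (Nat.choose (n + κ - k) n : ℝ) * (Nat.factorial n : ℝ)
      = ∏ i ∈ Finset.range n, (((κ : ℝ) + 1) + ((i : ℝ) - k)) := by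
    have h2 := descPochhammer_eval_eq_descFactorial ℝ (n + κ - k) n
    rw [descPochhammer_eval_eq_prod_range, Nat.descFactorial_eq_factorial_mul_choose] at h2
    push_cast at h2
    rw [mul_comm, ← h2, ← Finset.prod_range_reflect]
    apply Finset.prod_congr rfl
    intro i hi
    have hi' := Finset.mem_range.1 hi
    have : n - 1 - i = n - (1 + i) := by omega
    rw [this, Nat.cast_sub (by omega), Nat.cast_sub (by omega)]
    push_cast
    ring
  rw [div_eq_div_iff hn (by positivity), h1]
  have h3 : ((κ : ℝ) + 1) ^ n = ∏ i ∈ Finset.range n, ((κ : ℝ) + 1) := by simp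
  rw [h3, ← Finset.prod_mul_distrib]
  apply Finset.prod_congr rfl
  intro i _
  field_simp

theorem eF_What (κ n k : ℕ) : eF n k (-(1 / ((κ : ℝ) + 1))) = Whatbucket κ n k := by
  unfold eF Whatbucket
  split_ifs with h
  swap; · rfl
  have hκ : ((κ : ℝ) + 1) ≠ 0 := by positivity
  have hn : (Nat.factorial n : ℝ) ≠ 0 := by positivity
  have h1 : (Nat.choose (κ + k + 1) n : ℝ) * (Nat.factorial n : ℝ)
      = ∏ i ∈ Finset.range n, (((κ : ℝ) + 1) - ((i : ℝ) - k)) := by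
    have h2 := descPochhammer_eval_eq_descFactorial ℝ (κ + k + 1) n
    rw [descPochhammer_eval_eq_prod_range, Nat.descFactorial_eq_factorial_mul_choose] at h2
    push_cast at h2
    rw [mul_comm, ← h2]
    apply Finset.prod_congr rfl
    intro i hi
    ring
  rw [div_eq_div_iff hn (by positivity), h1]
  have h3 : ((κ : ℝ) + 1) ^ n = ∏ i ∈ Finset.range n, ((κ : ℝ) + 1) := by simp
  rw [h3, ← Finset.prod_mul_distrib]
  apply Finset.prod_congr rfl
  intro i _
  field_simp
  ring

theorem eF_inf (n k : ℕ) : eF n k 0 = Winf n k := by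
  unfold eF Winf
  simp

theorem eF_cont (n k : ℕ) : Continuous (eF n k) := by
  unfold eF
  split_ifs <;> fun_prop

theorem eF_one (t : ℝ) : eF 1 0 t = 1 := by simp [eF]

theorem eF_zero (n k : ℕ) (t : ℝ) (h : n = 0 ∨ n ≤ k) : eF n k t = 0 := by
  unfold eF
  rw [if_neg (by omega)]

theorem eF_succ1 (n k : ℕ) (t : ℝ) (hn : 1 ≤ n) (hk : k ≤ n - 1) :
    ((n : ℝ) + 1) * eF (n + 1) k t = (1 + ((n : ℝ) - k) * t) * eF n k t := by
  unfold eF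
  rw [if_pos (by omega), if_pos ⟨hn, hk⟩, Finset.prod_range_succ, Nat.factorial_succ]
  have : (Nat.factorial n : ℝ) ≠ 0 := by positivity
  generalize (∏ i ∈ Finset.range n, (1 + ((i : ℝ) - (k : ℝ)) * t)) = P
  push_cast
  field_simp

theorem eF_succ2 (n k : ℕ) (t : ℝ) (hn : 1 ≤ n) (hk : k ≤ n - 1) :
    ((n : ℝ) + 1) * eF (n + 1) (k + 1) t = (1 - ((k : ℝ) + 1) * t) * eF n k t := by
  unfold eF
  rw [if_pos (by omega), if_pos ⟨hn, hk⟩, Finset.prod_range_succ', Nat.factorial_succ]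
  have : (Nat.factorial n : ℝ) ≠ 0 := by positivity
  have h : ∀ i ∈ Finset.range n, (1 + (((i + 1 : ℕ) : ℝ) - ((k + 1 : ℕ) : ℝ)) * t)
     = 1 + ((i : ℝ) - k) * t := by
    intro i _; push_cast; ring
  rw [Finset.prod_congr rfl h]
  generalize (∏ i ∈ Finset.range n, (1 + ((i : ℝ) - (k : ℝ)) * t)) = P
  push_cast
  field_simp
  ring

theorem eF_t (n k : ℕ) (t : ℝ) (hn : 1 ≤ n) (hk : k ≤ n - 1) :
    t * eF n k t = eF (n + 1) k t - eF (n + 1) (k + 1) t := by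
  have h1 := eF_succ1 n k t hn hk
  have h2 := eF_succ2 n k t hn hk
  have : ((n : ℝ) + 1) ≠ 0 := by positivity
  apply mul_left_cancel₀ this
  linear_combination h2 - h1

/-- Nonnegative solutions without normalization. -/
def preV (V : ℕ → ℕ → ℝ) : Prop :=
  (∀ n k : ℕ, n = 0 ∨ n ≤ k → V n k = 0) ∧
  (∀ n k : ℕ, 0 ≤ V n k) ∧
  (∀ n k : ℕ, 1 ≤ n → k ≤ n - 1 →
    V n k = ((k : ℝ) + 1) * V (n + 1) k + ((n : ℝ) - (k : ℝ)) * V (n + 1) (k + 1))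

theorem memV_iff (V : ℕ → ℕ → ℝ) : memV V ↔ preV V ∧ V 1 0 = 1 := by
  unfold memV preV; tauto

theorem preV_le {V : ℕ → ℕ → ℝ} (h : preV V) (n k : ℕ) : V n k ≤ V 1 0 := by
  obtain ⟨h0, hp, hr⟩ := h
  rcases Nat.eq_zero_or_pos n with rfl | hn
  · rw [h0 0 k (Or.inl rfl)]; exact hp _ _
  induction n, hn using Nat.le_induction generalizing k with
  | base =>
    rcases Nat.eq_zero_or_pos k with rfl | hk
    · exact le_rfl
    · rw [h0 1 k (Or.inr hk)]; exact hp _ _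
  | succ n hn ih =>
    by_cases hk : k ≤ n - 1
    · refine le_trans ?_ (ih k)
      have h1 := hr n k hn hk
      have hc : (k : ℝ) + 1 ≤ n := by exact_mod_cast (by omega : k + 1 ≤ n)
      have := mul_nonneg (by linarith : (0 : ℝ) ≤ (n : ℝ) - k) (hp (n + 1) (k + 1))
      have := mul_nonneg (Nat.cast_nonneg k : (0 : ℝ) ≤ k) (hp (n + 1) k)
      linarith
    · by_cases hk2 : k = n
      · refine le_trans ?_ (ih (n - 1))
        have h1 := hr n (n - 1) hn le_rfl
        rw [Nat.sub_add_cancel hn, Nat.cast_sub hn] at h1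
        subst hk2
        have := mul_nonneg (Nat.cast_nonneg k : (0 : ℝ) ≤ k) (hp (k + 1) (k - 1))
        push_cast at h1
        linarith
      · rw [h0 (n + 1) k (Or.inr (by omega))]; exact hp _ _

/-- Multiplication by `t`. -/
def shT (V : ℕ → ℕ → ℝ) (n k : ℕ) : ℝ :=
  if 1 ≤ n ∧ k ≤ n - 1 then V (n + 1) k - V (n + 1) (k + 1) else 0

theorem shT_rec {V : ℕ → ℕ → ℝ} (h : preV V) (n k : ℕ) (hn : 1 ≤ n) (hk : k ≤ n - 1) :
    shT V n k = ((k : ℝ) + 1) * shT V (n + 1) k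
      + ((n : ℝ) - (k : ℝ)) * shT V (n + 1) (k + 1) := by
  unfold shT
  rw [if_pos ⟨hn, hk⟩, if_pos (by omega), if_pos (by omega)]
  rw [h.2.2 (n + 1) k (by omega) (by omega), h.2.2 (n + 1) (k + 1) (by omega) (by omega)]
  push_cast
  ring

theorem preV_add {V : ℕ → ℕ → ℝ} (h : preV V) : preV (fun n k => V n k + shT V n k) := by
  refine ⟨?_, ?_, ?_⟩
  · intro n k hnk
    simp only
    rw [h.1 n k hnk]; unfold shT; rw [if_neg (by omega)]; simp
  · intro n k
    by_cases hc : 1 ≤ n ∧ k ≤ n - 1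
    · simp only
      have h1 := h.2.2 n k hc.1 hc.2
      unfold shT; rw [if_pos hc]
      have hc' : (k : ℝ) + 1 ≤ n := by exact_mod_cast (by omega : k + 1 ≤ n)
      have := mul_nonneg (by linarith : (0 : ℝ) ≤ (n : ℝ) - k - 1) (h.2.1 (n + 1) (k + 1))
      have := mul_nonneg (by positivity : (0 : ℝ) ≤ k + 2) (h.2.1 (n + 1) k)
      linarith
    · simp only
      unfold shT; rw [if_neg hc, add_zero]; exact h.2.1 _ _
  · intro n k hn hk
    simp only
    rw [shT_rec h n k hn hk, h.2.2 n k hn hk]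
    ring

theorem preV_sub {V : ℕ → ℕ → ℝ} (h : preV V) : preV (fun n k => V n k - shT V n k) := by
  refine ⟨?_, ?_, ?_⟩
  · intro n k hnk
    simp only
    rw [h.1 n k hnk]; unfold shT; rw [if_neg (by omega)]; simp
  · intro n k
    by_cases hc : 1 ≤ n ∧ k ≤ n - 1
    · simp only
      have h1 := h.2.2 n k hc.1 hc.2
      unfold shT; rw [if_pos hc]
      have hc' : (k : ℝ) + 1 ≤ n := by exact_mod_cast (by omega : k + 1 ≤ n)
      have := mul_nonneg (by linarith : (0 : ℝ) ≤ (n : ℝ) - k + 1) (h.2.1 (n + 1) (k + 1))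
      have := mul_nonneg (by positivity : (0 : ℝ) ≤ k) (h.2.1 (n + 1) k)
      linarith
    · simp only
      unfold shT; rw [if_neg hc, sub_zero]; exact h.2.1 _ _
  · intro n k hn hk
    simp only
    rw [shT_rec h n k hn hk, h.2.2 n k hn hk]
    ring

theorem preV_scale {V : ℕ → ℕ → ℝ} (h : preV V) {c : ℝ} (hc : 0 ≤ c) :
    preV (fun n k => c * V n k) := by
  refine ⟨?_, ?_, ?_⟩
  · intro n k hnk
    simp only
    rw [h.1 n k hnk]; simp
  · intro n k
    exact mul_nonneg hc (h.2.1 _ _)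
  · intro n k hn hk
    simp only
    rw [h.2.2 n k hn hk]
    ring

/-- Eigenvectors of `shT` are the evaluations. -/
theorem eq_eF {V : ℕ → ℕ → ℝ} (h : memV V) (τ : ℝ) (hτ : ∀ n k, shT V n k = τ * V n k) (n k : ℕ) :
    V n k = eF n k τ := by
  obtain ⟨h0, hp, h1, hr⟩ := h
  rcases Nat.eq_zero_or_pos n with rfl | hn
  · rw [h0 0 k (Or.inl rfl), eF_zero _ _ _ (Or.inl rfl)]
  have key1 : ∀ n k : ℕ, 1 ≤ n → k ≤ n - 1 →
      ((n : ℝ) + 1) * V (n + 1) k = (1 + ((n : ℝ) - k) * τ) * V n k := by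
    intro n k hn hk
    have a := hr n k hn hk
    have b := hτ n k
    unfold shT at b
    rw [if_pos ⟨hn, hk⟩] at b
    linear_combination ((n : ℝ) - k) * b - a
  have key2 : ∀ n k : ℕ, 1 ≤ n → k ≤ n - 1 →
      ((n : ℝ) + 1) * V (n + 1) (k + 1) = (1 - ((k : ℝ) + 1) * τ) * V n k := by
    intro n k hn hk
    have a := hr n k hn hk
    have b := hτ n k
    unfold shT at b
    rw [if_pos ⟨hn, hk⟩] at b
    linear_combination -((k : ℝ) + 1) * b - a
  induction n, hn using Nat.le_induction generalizing k with
  | base =>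
    rcases Nat.eq_zero_or_pos k with rfl | hk
    · rw [h1, eF_one]
    · rw [h0 1 k (Or.inr hk), eF_zero _ _ _ (Or.inr hk)]
  | succ n hn ih =>
    have hne : ((n : ℝ) + 1) ≠ 0 := by positivity
    by_cases hk : k ≤ n - 1
    · apply mul_left_cancel₀ hne
      rw [key1 n k hn hk, eF_succ1 n k τ hn hk, ih]
    · by_cases hk2 : k = n
      · obtain ⟨m, rfl⟩ : ∃ m, k = m + 1 := ⟨k - 1, by omega⟩
        apply mul_left_cancel₀ hne
        rw [key2 n m hn (by omega), eF_succ2 n m τ hn (by omega), ih]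
      · rw [h0 (n + 1) k (Or.inr (by omega)), eF_zero _ _ _ (Or.inr (by omega))]

/-- positivity of the top diagonal forces `τ ∉ (1/(κ+2), 1/(κ+1))`. -/
theorem pos_discrete {τ : ℝ} (hτ : 0 < τ)
    (h : ∀ n : ℕ, 0 ≤ ∏ i ∈ Finset.range n, (1 - ((i : ℝ) + 1) * τ)) :
    ∃ κ : ℕ, τ = 1 / ((κ : ℝ) + 1) := by
  classical
  have hex : ∃ κ : ℕ, 1 - ((κ : ℝ) + 1) * τ ≤ 0 := by
    obtain ⟨N, hN⟩ := exists_nat_gt (1 / τ)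
    refine ⟨N, ?_⟩
    rw [div_lt_iff₀ hτ] at hN
    nlinarith
  refine ⟨Nat.find hex, ?_⟩
  have h1 := Nat.find_spec hex
  have h2 : 0 < ∏ i ∈ Finset.range (Nat.find hex), (1 - ((i : ℝ) + 1) * τ) := by
    apply Finset.prod_pos
    intro i hi
    have := Nat.find_min hex (Finset.mem_range.1 hi)
    exact not_le.1 this
  have h3 := h (Nat.find hex + 1)
  rw [Finset.prod_range_succ] at h3
  have h4 := nonneg_of_mul_nonneg_right h3 h2
  have h5 : 1 - ((Nat.find hex : ℝ) + 1) * τ = 0 := le_antisymm h1 h4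
  have : ((Nat.find hex : ℝ) + 1) ≠ 0 := by positivity
  rw [eq_div_iff this]
  linarith

theorem eF_discrete {τ : ℝ} (h : ∀ n k, 0 ≤ eF n k τ) :
    τ = 0 ∨ (∃ κ : ℕ, τ = 1 / ((κ : ℝ) + 1)) ∨ (∃ κ : ℕ, τ = -(1 / ((κ : ℝ) + 1))) := by
  rcases lt_trichotomy τ 0 with hneg | h0 | hpos
  · right; right
    obtain ⟨κ, hκ⟩ := pos_discrete (τ := -τ) (by linarith) (by
      intro n
      have h1 := h (n + 1) 0
      unfold eF at h1
      rw [if_pos (by omega), Finset.prod_range_succ'] at h1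
      have hf : (0 : ℝ) < (Nat.factorial (n + 1) : ℝ) := by positivity
      have h2 := (le_div_iff₀ hf).1 h1
      simp only [Nat.cast_zero, sub_self, zero_mul, add_zero, mul_one, sub_zero] at h2
      refine h2.trans_eq (Finset.prod_congr rfl fun i _ => ?_)
      push_cast; ring)
    exact ⟨κ, by linarith⟩
  · exact Or.inl h0
  · right; left
    refine pos_discrete hpos ?_
    intro n
    have h1 := h (n + 1) n
    unfold eF at h1
    rw [if_pos (by omega), Finset.prod_range_succ] at h1
    have hf : (0 : ℝ) < (Nat.factorial (n + 1) : ℝ) := by positivity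
    have h2 := (le_div_iff₀ hf).1 h1
    simp only [sub_self, zero_mul, add_zero, mul_one] at h2
    rw [← Finset.prod_range_reflect] at h2
    refine h2.trans_eq (Finset.prod_congr rfl fun i hi => ?_)
    have hi' := Finset.mem_range.1 hi
    have : n - 1 - i = n - (1 + i) := by omega
    rw [this, Nat.cast_sub (by omega)]
    push_cast; ring

/-- Sub-probability weights. -/
def subProb (ι : Type) : Set (ι → ℝ) :=
  {p | (∀ i, 0 ≤ p i) ∧ ∀ s : Finset ι, ∑ i ∈ s, p i ≤ 1}

theorem subProb_summable {ι : Type} {p : ι → ℝ} (hp : p ∈ subProb ι) : Summable p :=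
  summable_of_sum_le hp.1 hp.2

theorem subProb_tsum_le {ι : Type} {p : ι → ℝ} (hp : p ∈ subProb ι) : ∑' i, p i ≤ 1 :=
  (subProb_summable hp).tsum_le_of_sum_le hp.2

theorem subProb_convex (ι : Type) : Convex ℝ (subProb ι) := by
  intro p hp q hq a b ha hb hab
  refine ⟨fun i => ?_, fun s => ?_⟩
  · have := hp.1 i
    have := hq.1 i
    simp only [Pi.add_apply, Pi.smul_apply, smul_eq_mul]
    positivity
  · simp only [Pi.add_apply, Pi.smul_apply, smul_eq_mul, Finset.sum_add_distrib, ← Finset.mul_sum]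
    have := mul_le_mul_of_nonneg_left (hp.2 s) ha
    have := mul_le_mul_of_nonneg_left (hq.2 s) hb
    linarith

theorem subProb_compact (ι : Type) : IsCompact (subProb ι) := by
  have hc : IsCompact (Set.pi Set.univ (fun _ : ι => Set.Icc (0 : ℝ) 1)) :=
    isCompact_univ_pi fun _ => isCompact_Icc
  refine hc.of_isClosed_subset ?_ ?_
  · have : subProb ι = (⋂ i, {p : ι → ℝ | 0 ≤ p i}) ∩ ⋂ s : Finset ι, {p | ∑ i ∈ s, p i ≤ 1} := by
      ext p; simp [subProb]
    rw [this]
    refine IsClosed.inter (isClosed_iInter fun i => ?_) (isClosed_iInter fun s => ?_)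
    · exact isClosed_le continuous_const (continuous_apply i)
    · exact isClosed_le (by fun_prop) continuous_const
  · intro p hp i _
    refine ⟨hp.1 i, ?_⟩
    simpa using hp.2 {i}

theorem bdd_of_small {ι : Type} {c : ι → ℝ}
    (hc : ∀ ε > 0, ∃ s : Finset ι, ∀ i ∉ s, |c i| ≤ ε) : ∃ C : ℝ, ∀ i, |c i| ≤ C := by
  classical
  obtain ⟨s, hs⟩ := hc 1 one_pos
  refine ⟨1 + ∑ i ∈ s, |c i|, fun i => ?_⟩
  by_cases hi : i ∈ s
  · have := Finset.single_le_sum (f := fun i => |c i|) (fun i _ => abs_nonneg (c i)) hi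
    linarith
  · have := hs i hi
    have := Finset.sum_nonneg (s := s) (f := fun i => |c i|) (fun i _ => abs_nonneg (c i))
    linarith

theorem summable_mul_bdd {ι : Type} {p c : ι → ℝ} (hp : Summable p) (hp0 : ∀ i, 0 ≤ p i) {C : ℝ}
    (hc : ∀ i, |c i| ≤ C) : Summable (fun i => p i * c i) := by
  refine Summable.of_norm_bounded (hp.mul_right C) fun i => ?_
  rw [Real.norm_eq_abs, abs_mul, abs_of_nonneg (hp0 i)]
  exact mul_le_mul_of_nonneg_left (hc i) (hp0 i)

theorem subProb_cont {ι : Type} {c : ι → ℝ}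
    (hc : ∀ ε > 0, ∃ s : Finset ι, ∀ i ∉ s, |c i| ≤ ε) :
    ContinuousOn (fun p : ι → ℝ => ∑' i, p i * c i) (subProb ι) := by
  classical
  obtain ⟨C, hC⟩ := bdd_of_small hc
  apply continuousOn_of_uniform_approx_of_continuousOn
  intro u hu
  obtain ⟨ε, hε, hεu⟩ := Metric.mem_uniformity_dist.1 hu
  obtain ⟨s, hs⟩ := hc (ε / 2) (by positivity)
  refine ⟨fun p => ∑ i ∈ s, p i * c i, by fun_prop, fun p hp => hεu ?_⟩
  have hps := subProb_summable hp
  have h1 : ∑ i ∈ s, p i * c i = ∑' i, p i * (if i ∈ s then c i else 0) := by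
    rw [tsum_eq_sum (s := s)]
    · exact Finset.sum_congr rfl fun i hi => by rw [if_pos hi]
    · intro i hi; rw [if_neg hi, mul_zero]
  have hb : ∀ i, |c i - (if i ∈ s then c i else 0)| ≤ ε / 2 := by
    intro i
    split_ifs with hi
    · simp; positivity
    · simpa using hs i hi
  have hb2 : ∀ i, |(if i ∈ s then c i else 0)| ≤ C := by
    intro i
    split_ifs with hi
    · exact hC i
    · simpa using (abs_nonneg _).trans (hC i)
  rw [Real.dist_eq]
  simp only
  rw [h1, ← (summable_mul_bdd hps hp.1 hC).tsum_sub (summable_mul_bdd hps hp.1 hb2)]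
  have h2 : ∀ i, p i * c i - p i * (if i ∈ s then c i else 0)
      = p i * (c i - (if i ∈ s then c i else 0)) := fun i => by ring
  rw [tsum_congr h2]
  have h3 : ‖∑' i, p i * (c i - (if i ∈ s then c i else 0))‖ ≤ ∑' i, p i * (ε / 2) := by
    refine tsum_of_norm_bounded (hps.mul_right _).hasSum fun i => ?_
    rw [Real.norm_eq_abs, abs_mul, abs_of_nonneg (hp.1 i)]
    exact mul_le_mul_of_nonneg_left (hb i) (hp.1 i)
  rw [tsum_mul_right] at h3
  have h4 := mul_le_mul_of_nonneg_right (subProb_tsum_le hp) (by positivity : 0 ≤ ε / 2)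
  rw [Real.norm_eq_abs] at h3
  linarith

/-- The nonzero points of the boundary. -/
noncomputable def bpt : ℕ ⊕ ℕ → ℝ
  | Sum.inl κ => 1 / ((κ : ℝ) + 1)
  | Sum.inr κ => -(1 / ((κ : ℝ) + 1))

theorem bpt_small (n k : ℕ) : ∀ ε > 0, ∃ s : Finset (ℕ ⊕ ℕ), ∀ i ∉ s,
    |eF n k (bpt i) - eF n k 0| ≤ ε := by
  intro ε hε
  have hc := (eF_cont n k).tendsto 0
  have h1 : Filter.Tendsto (fun κ : ℕ => 1 / ((κ : ℝ) + 1)) Filter.atTop (nhds 0) :=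
    tendsto_one_div_add_atTop_nhds_zero_nat
  have h2 : Filter.Tendsto (fun κ : ℕ => -(1 / ((κ : ℝ) + 1))) Filter.atTop (nhds 0) := by
    simpa using h1.neg
  obtain ⟨N1, hN1⟩ := Metric.tendsto_atTop.1 (hc.comp h1) ε hε
  obtain ⟨N2, hN2⟩ := Metric.tendsto_atTop.1 (hc.comp h2) ε hε
  refine ⟨(Finset.range N1).disjSum (Finset.range N2), ?_⟩
  rintro (i | i) hi
  · have : N1 ≤ i := by simpa using hi
    exact (hN1 i this).le
  · have : N2 ≤ i := by simpa using hi
    exact (hN2 i this).le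

/-- The mixture map. -/
noncomputable def mix (p : ℕ ⊕ ℕ → ℝ) (n k : ℕ) : ℝ :=
  eF n k 0 + ∑' i, p i * (eF n k (bpt i) - eF n k 0)

theorem mix_summable {p : ℕ ⊕ ℕ → ℝ} (hp : p ∈ subProb (ℕ ⊕ ℕ)) (n k : ℕ) :
    Summable (fun i => p i * (eF n k (bpt i) - eF n k 0)) := by
  obtain ⟨C, hC⟩ := bdd_of_small (bpt_small n k)
  exact summable_mul_bdd (subProb_summable hp) hp.1 hC

theorem mix_compact : IsCompact (mix '' subProb (ℕ ⊕ ℕ)) := by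
  refine (subProb_compact _).image_of_continuousOn ?_
  refine continuousOn_pi.2 fun n => continuousOn_pi.2 fun k => ?_
  exact continuousOn_const.add (subProb_cont (bpt_small n k))

theorem mix_convex : Convex ℝ (mix '' subProb (ℕ ⊕ ℕ)) := by
  rintro _ ⟨p, hp, rfl⟩ _ ⟨q, hq, rfl⟩ a b ha hb hab
  refine ⟨a • p + b • q, subProb_convex _ hp hq ha hb hab, ?_⟩
  ext n k
  have h1 := (mix_summable hp n k).mul_left a
  have h2 := (mix_summable hq n k).mul_left b
  simp only [mix, Pi.add_apply, Pi.smul_apply, smul_eq_mul]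
  have : ∀ i, (a * p i + b * q i) * (eF n k (bpt i) - eF n k 0)
      = a * (p i * (eF n k (bpt i) - eF n k 0)) + b * (q i * (eF n k (bpt i) - eF n k 0)) := by
    intro i; ring
  rw [tsum_congr this, h1.tsum_add h2, tsum_mul_left, tsum_mul_left]
  linear_combination -(eF n k 0) * hab

theorem mix_single (i : ℕ ⊕ ℕ) :
    (fun n k => eF n k (bpt i)) ∈ mix '' subProb (ℕ ⊕ ℕ) := by
  classical
  refine ⟨Pi.single i 1, ⟨fun j => ?_, fun s => ?_⟩, ?_⟩
  · by_cases h : j = i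
    · subst h; simp
    · simp [h]
  · simp only [Pi.single_apply, Finset.sum_ite_eq']; split_ifs <;> simp
  · ext n k
    unfold mix
    rw [tsum_eq_single i]
    · simp
    · intro j hj; simp [hj]

theorem mix_zero : (fun n k => eF n k 0) ∈ mix '' subProb (ℕ ⊕ ℕ) := by
  refine ⟨0, ⟨fun j => le_rfl, fun s => by simp⟩, ?_⟩
  ext n k
  simp [mix]

theorem memV_compact : IsCompact {V | memV V} := by
  have hc : IsCompact (Set.pi Set.univ (fun _ : ℕ => Set.pi Set.univ
      (fun _ : ℕ => Set.Icc (0 : ℝ) 1))) :=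
    isCompact_univ_pi fun _ => isCompact_univ_pi fun _ => isCompact_Icc
  refine hc.of_isClosed_subset ?_ ?_
  · have hap : ∀ n k : ℕ, Continuous (fun V : ℕ → ℕ → ℝ => V n k) := fun n k => by fun_prop
    simp only [memV, Set.ofPred_and, Set.ofPred_forall]
    refine IsClosed.inter ?_ (IsClosed.inter ?_ (IsClosed.inter ?_ ?_))
    · exact isClosed_iInter fun n => isClosed_iInter fun k => isClosed_iInter fun _ =>
        isClosed_eq (hap n k) continuous_const
    · exact isClosed_iInter fun n => isClosed_iInter fun k =>
        isClosed_le continuous_const (hap n k)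
    · exact isClosed_eq (hap 1 0) continuous_const
    · exact isClosed_iInter fun n => isClosed_iInter fun k => isClosed_iInter fun _ =>
        isClosed_iInter fun _ => isClosed_eq (hap n k)
          (((hap (n + 1) k).const_mul _).add ((hap (n + 1) (k + 1)).const_mul _))
  · intro V hV n _ k _
    have hV' := (memV_iff V).1 hV
    refine ⟨hV'.1.2.1 n k, ?_⟩
    rw [← hV'.2]
    exact preV_le hV'.1 n k

theorem memV_convex : Convex ℝ {V | memV V} := by
  intro V hV U hU a b ha hb hab
  obtain ⟨v0, vp, v1, vr⟩ := hV
  obtain ⟨u0, up, u1, ur⟩ := hU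
  refine ⟨?_, ?_, ?_, ?_⟩
  · intro n k h
    simp [v0 n k h, u0 n k h]
  · intro n k
    have := vp n k
    have := up n k
    simp only [Pi.add_apply, Pi.smul_apply, smul_eq_mul]
    positivity
  · simp [v1, u1, hab]
  · intro n k hn hk
    simp only [Pi.add_apply, Pi.smul_apply, smul_eq_mul]
    rw [vr n k hn hk, ur n k hn hk]
    ring

theorem extreme_eigen_s12 {V : ℕ → ℕ → ℝ} (hV : V ∈ Set.extremePoints ℝ {V | memV V}) :
    ∃ τ : ℝ, ∀ n k, shT V n k = τ * V n k := by
  obtain ⟨hm, hext⟩ := hV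
  obtain ⟨hpre, h1⟩ := (memV_iff V).1 hm
  have hA := preV_add hpre
  have hB := preV_sub hpre
  set τ := shT V 1 0 with hτ
  refine ⟨τ, ?_⟩
  have hA0 : 0 ≤ 1 + τ := by
    have := hA.2.1 1 0
    simp only at this
    rw [h1] at this; exact this
  have hB0 : 0 ≤ 1 - τ := by
    have := hB.2.1 1 0
    simp only at this
    rw [h1] at this; exact this
  rcases hA0.eq_or_lt with hA1 | hA1
  · intro n k
    have h2 := preV_le hA n k
    have h3 := hA.2.1 n k
    simp only at h2 h3
    rw [h1, ← hτ, ← hA1] at h2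
    have : τ = -1 := by linarith
    rw [this]; linarith
  rcases hB0.eq_or_lt with hB1 | hB1
  · intro n k
    have h2 := preV_le hB n k
    have h3 := hB.2.1 n k
    simp only at h2 h3
    rw [h1, ← hτ, ← hB1] at h2
    have : τ = 1 := by linarith
    rw [this]; linarith
  have mA : memV (fun n k => (1 + τ)⁻¹ * (V n k + shT V n k)) := by
    rw [memV_iff]
    refine ⟨preV_scale hA (by positivity), ?_⟩
    rw [h1, ← hτ]; field_simp
  have mB : memV (fun n k => (1 - τ)⁻¹ * (V n k - shT V n k)) := by
    rw [memV_iff]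
    refine ⟨preV_scale hB (by positivity), ?_⟩
    rw [h1, ← hτ]; field_simp
  have hs := hext mA mB (by
    refine ⟨(1 + τ) / 2, (1 - τ) / 2, by positivity, by positivity, by ring, ?_⟩
    ext n k
    simp only [Pi.add_apply, Pi.smul_apply, smul_eq_mul]
    field_simp
    ring)
  intro n k
  have h4 := congrFun (congrFun hs n) k
  field_simp at h4
  linarith

theorem memV_subset_mix : {V | memV V} ⊆ mix '' subProb (ℕ ⊕ ℕ) := by
  rw [← closure_convexHull_extremePoints memV_compact memV_convex]
  refine closure_minimal (convexHull_min ?_ mix_convex) mix_compact.isClosed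
  intro V hV
  obtain ⟨τ, hτ⟩ := extreme_eigen_s12 hV
  have hF := eq_eF hV.1 τ hτ
  have hV' : V = fun n k => eF n k τ := by ext n k; exact hF n k
  have hpos : ∀ n k, 0 ≤ eF n k τ := fun n k => by rw [← hF]; exact hV.1.2.1 n k
  rw [hV']
  rcases eF_discrete hpos with h0 | ⟨κ, h⟩ | ⟨κ, h⟩
  · rw [h0]; exact mix_zero
  · rw [h]; exact mix_single (Sum.inl κ)
  · rw [h]; exact mix_single (Sum.inr κ)

/-- Uniqueness core: a summable sequence with vanishing power sums is zero. -/
theorem zero_of_moments {e : ℕ → ℝ} (he : Summable e)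
    (h : ∀ m : ℕ, 1 ≤ m → ∑' j, e j * ((1 / ((j : ℝ) + 1)) ^ 2) ^ m = 0) : ∀ j, e j = 0 := by
  intro κ
  induction κ using Nat.strong_induction_on with
  | _ κ ih =>
  have hκ : (0 : ℝ) < (κ : ℝ) + 1 := by positivity
  have h0 : ∀ m : ℕ, 1 ≤ m → ∑' j : ℕ, e j * ((((κ : ℝ) + 1) / ((j : ℝ) + 1)) ^ 2) ^ m = 0 := by
    intro m hm
    have := h m hm
    have h2 : ∀ j : ℕ, e j * ((((κ : ℝ) + 1) / ((j : ℝ) + 1)) ^ 2) ^ m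
        = (((κ : ℝ) + 1) ^ 2) ^ m * (e j * ((1 / ((j : ℝ) + 1)) ^ 2) ^ m) := by
      intro j
      rw [div_eq_mul_one_div, mul_pow, mul_pow]; ring
    rw [tsum_congr h2, tsum_mul_left, this, mul_zero]
  have hle : ∀ j : ℕ, κ ≤ j → (((κ : ℝ) + 1) / ((j : ℝ) + 1)) ≤ 1 := by
    intro j hj
    rw [div_le_one (by positivity)]
    have : (κ : ℝ) ≤ j := by exact_mod_cast hj
    linarith
  have ht : Filter.Tendsto
      (fun m : ℕ => ∑' j : ℕ, e j * ((((κ : ℝ) + 1) / ((j : ℝ) + 1)) ^ 2) ^ m) Filter.atTop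
      (nhds (∑' j : ℕ, if j = κ then e κ else 0)) := by
    refine tendsto_tsum_of_dominated_convergence he.norm ?_ ?_
    · intro j
      rcases lt_trichotomy j κ with hj | hj | hj
      · rw [ih j hj, if_neg hj.ne]; simp
      · subst hj
        rw [if_pos rfl, div_self hκ.ne']; simp
      · rw [if_neg hj.ne']
        have h1 : (((κ : ℝ) + 1) / ((j : ℝ) + 1)) < 1 := by
          rw [div_lt_one (by positivity)]
          have : (κ : ℝ) < j := by exact_mod_cast hj
          linarith
        have h2 : (((κ : ℝ) + 1) / ((j : ℝ) + 1)) ^ 2 < 1 :=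
          pow_lt_one₀ (by positivity) h1 (by norm_num)
        simpa using (tendsto_pow_atTop_nhds_zero_of_lt_one (by positivity) h2).const_mul (e j)
    · refine Filter.Eventually.of_forall fun m j => ?_
      rcases lt_or_ge j κ with hj | hj
      · rw [ih j hj]; simp
      · rw [norm_mul]
        refine mul_le_of_le_one_right (norm_nonneg _) ?_
        rw [Real.norm_of_nonneg (by positivity)]
        exact pow_le_one₀ (by positivity) (pow_le_one₀ (by positivity) (hle j hj))
  rw [tsum_ite_eq] at ht
  refine tendsto_nhds_unique ht ?_
  refine tendsto_const_nhds.congr' ?_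
  filter_upwards [Filter.eventually_ge_atTop 1] with m hm
  exact (h0 m hm).symm

theorem summable_mul_cont {a : ℕ → ℝ} (ha : Summable a) {g : ℝ → ℝ} (hg : Continuous g)
    (σ : ℝ) : Summable (fun κ : ℕ => a κ * g (σ * (1 / ((κ : ℝ) + 1)))) := by
  have h1 : Filter.Tendsto (fun κ : ℕ => 1 / ((κ : ℝ) + 1)) Filter.atTop (nhds 0) :=
    tendsto_one_div_add_atTop_nhds_zero_nat
  have h2 : Filter.Tendsto (fun κ : ℕ => g (σ * (1 / ((κ : ℝ) + 1)))) Filter.atTop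
      (nhds (g (σ * 0))) := (hg.tendsto _).comp (h1.const_mul σ)
  obtain ⟨C, hC⟩ := h2.norm.bddAbove_range
  refine Summable.of_norm_bounded (ha.norm.mul_right C) fun i => ?_
  rw [norm_mul]
  exact mul_le_mul_of_nonneg_left (hC ⟨i, rfl⟩) (norm_nonneg _)

/-- Integration of `g` against the (signed) weights. -/
noncomputable def integ (a b : ℕ → ℝ) (s : ℝ) (g : ℝ → ℝ) : ℝ :=
  (∑' κ : ℕ, a κ * g (1 * (1 / ((κ : ℝ) + 1))))
    + (∑' κ : ℕ, b κ * g ((-1) * (1 / ((κ : ℝ) + 1)))) + s * g 0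

theorem integ_sub {a b : ℕ → ℝ} (ha : Summable a) (hb : Summable b) (s : ℝ) {g h : ℝ → ℝ}
    (hg : Continuous g) (hh : Continuous h) :
    integ a b s (fun t => g t - h t) = integ a b s g - integ a b s h := by
  unfold integ
  simp only [mul_sub]
  rw [(summable_mul_cont ha hg 1).tsum_sub (summable_mul_cont ha hh 1),
    (summable_mul_cont hb hg (-1)).tsum_sub (summable_mul_cont hb hh (-1))]
  ring

theorem integ_diff {a b a' b' : ℕ → ℝ} (ha : Summable a) (hb : Summable b) (ha' : Summable a')
    (hb' : Summable b') (s s' : ℝ) {g : ℝ → ℝ} (hg : Continuous g) :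
    integ (a - a') (b - b') (s - s') g = integ a b s g - integ a' b' s' g := by
  unfold integ
  simp only [Pi.sub_apply, sub_mul]
  rw [(summable_mul_cont ha hg 1).tsum_sub (summable_mul_cont ha' hg 1),
    (summable_mul_cont hb hg (-1)).tsum_sub (summable_mul_cont hb' hg (-1))]
  ring

theorem integ_eq (a b : ℕ → ℝ) (s : ℝ) (n k : ℕ) : integ a b s (eF n k) =
    (∑' κ : ℕ, a κ * Wbucket κ n k) + (∑' κ : ℕ, b κ * Whatbucket κ n k) + s * Winf n k := by
  unfold integ
  simp only [one_mul, neg_mul, eF_W, eF_What, eF_inf]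

theorem integ_moment {a b : ℕ → ℝ} (ha : Summable a) (hb : Summable b) (s : ℝ)
    (h : ∀ n k, integ a b s (eF n k) = 0) (m : ℕ) :
    ∀ n k, 1 ≤ n → k ≤ n - 1 → integ a b s (fun t => t ^ m * eF n k t) = 0 := by
  induction m with
  | zero => intro n k _ _; simpa using h n k
  | succ m ih =>
    intro n k hn hk
    have h1 : (fun t => t ^ (m + 1) * eF n k t)
        = fun t => t ^ m * eF (n + 1) k t - t ^ m * eF (n + 1) (k + 1) t := by
      ext t
      rw [← mul_sub, ← eF_t n k t hn hk]; ring
    have c1 := eF_cont (n + 1) k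
    have c2 := eF_cont (n + 1) (k + 1)
    rw [h1, integ_sub ha hb s (by fun_prop) (by fun_prop), ih _ _ (by omega) (by omega),
      ih _ _ (by omega) (by omega), sub_zero]

theorem integ_unique {a b : ℕ → ℝ} (ha : Summable a) (hb : Summable b) (s : ℝ)
    (h : ∀ n k, integ a b s (eF n k) = 0) : a = 0 ∧ b = 0 ∧ s = 0 := by
  have hm : ∀ m, integ a b s (fun t => t ^ m) = 0 := by
    intro m
    have := integ_moment ha hb s h m 1 0 le_rfl (by omega)
    simpa only [eF_one, mul_one] using this
  have h1 : ∀ j, a j + b j = 0 := by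
    refine zero_of_moments (ha.add hb) ?_
    intro m hm1
    have h2 := hm (2 * m)
    unfold integ at h2
    beta_reduce at h2
    rw [← Summable.tsum_add (summable_mul_cont ha (continuous_pow (2 * m)) 1)
      (summable_mul_cont hb (continuous_pow (2 * m)) (-1)),
      show (0 : ℝ) ^ (2 * m) = 0 from zero_pow (by omega), mul_zero,
      add_zero] at h2
    rw [← h2]
    refine tsum_congr fun j => ?_
    rw [mul_pow (-1 : ℝ), one_mul, pow_mul, pow_mul (-1 : ℝ)]
    norm_num
    ring
  have h3 : ∀ j : ℕ, (a j - b j) * (1 / ((j : ℝ) + 1)) = 0 := by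
    refine zero_of_moments (e := fun j : ℕ => (a j - b j) * (1 / ((j : ℝ) + 1))) ?_ ?_
    · simpa using summable_mul_cont (ha.sub hb) continuous_id 1
    intro m hm1
    have h2 := hm (2 * m + 1)
    unfold integ at h2
    beta_reduce at h2
    rw [← Summable.tsum_add (summable_mul_cont ha (continuous_pow (2 * m + 1)) 1)
      (summable_mul_cont hb (continuous_pow (2 * m + 1)) (-1)),
      show (0 : ℝ) ^ (2 * m + 1) = 0 from zero_pow (by omega), mul_zero,
      add_zero] at h2
    rw [← h2]
    refine tsum_congr fun j => ?_
    rw [mul_pow (-1 : ℝ), one_mul, pow_succ (-1 : ℝ), pow_mul (-1 : ℝ)]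
    generalize 1 / ((j : ℝ) + 1) = x
    norm_num
    ring
  have h4 : ∀ j, a j - b j = 0 := by
    intro j
    refine (mul_eq_zero.1 (h3 j)).resolve_right ?_
    positivity
  have h5 : a = 0 := by
    ext j
    have := h1 j
    have := h4 j
    simp only [Pi.zero_apply]; linarith
  have h6 : b = 0 := by
    ext j
    have := h1 j
    have := h4 j
    simp only [Pi.zero_apply]; linarith
  refine ⟨h5, h6, ?_⟩
  have := hm 0
  rw [h5, h6] at this
  simpa [integ] using this

theorem stmt12 (V : ℕ → ℕ → ℝ) (hV : memV V) :
    ∃! pqr : (ℕ → ℝ) × (ℕ → ℝ) × ℝ,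
      (∀ κ : ℕ, 0 ≤ pqr.1 κ) ∧ (∀ κ : ℕ, 0 ≤ pqr.2.1 κ) ∧ 0 ≤ pqr.2.2 ∧
      Summable pqr.1 ∧ Summable pqr.2.1 ∧
      (∑' κ : ℕ, pqr.1 κ) + (∑' κ : ℕ, pqr.2.1 κ) + pqr.2.2 = 1 ∧
      (∀ n k : ℕ,
        Summable (fun κ : ℕ => pqr.1 κ * Wbucket κ n k) ∧
        Summable (fun κ : ℕ => pqr.2.1 κ * Whatbucket κ n k) ∧
        V n k = (∑' κ : ℕ, pqr.1 κ * Wbucket κ n k) +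
          (∑' κ : ℕ, pqr.2.1 κ * Whatbucket κ n k) + pqr.2.2 * Winf n k) := by
  apply existsUnique_of_exists_of_unique
  · obtain ⟨p, hp, hpV⟩ := memV_subset_mix hV
    have hps := subProb_summable hp
    have s1 : Summable (fun κ => p (Sum.inl κ)) := hps.comp_injective Sum.inl_injective
    have s2 : Summable (fun κ => p (Sum.inr κ)) := hps.comp_injective Sum.inr_injective
    have hsum : ∑' i, p i = (∑' κ, p (Sum.inl κ)) + ∑' κ, p (Sum.inr κ) :=
      Summable.tsum_sum s1 s2
    have hle := subProb_tsum_le hp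
    have w1 : ∀ n k, Summable (fun κ => p (Sum.inl κ) * Wbucket κ n k) := by
      intro n k
      have := summable_mul_cont s1 (eF_cont n k) 1
      simpa only [one_mul, eF_W] using this
    have w2 : ∀ n k, Summable (fun κ => p (Sum.inr κ) * Whatbucket κ n k) := by
      intro n k
      have := summable_mul_cont s2 (eF_cont n k) (-1)
      simpa only [one_mul, neg_mul, eF_What] using this
    refine ⟨(fun κ => p (Sum.inl κ), fun κ => p (Sum.inr κ), 1 - ∑' i, p i), fun κ => hp.1 _,
      fun κ => hp.1 _, by simpa using hle, s1, s2, by simp only; rw [hsum]; ring,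
      fun n k => ⟨w1 n k, w2 n k, ?_⟩⟩
    have e1 : ∀ κ : ℕ, p (Sum.inl κ) * (eF n k (bpt (Sum.inl κ)) - eF n k 0)
        = p (Sum.inl κ) * Wbucket κ n k - p (Sum.inl κ) * Winf n k := by
      intro κ
      rw [show bpt (Sum.inl κ) = 1 / ((κ : ℝ) + 1) from rfl, eF_W, eF_inf]; ring
    have e2 : ∀ κ : ℕ, p (Sum.inr κ) * (eF n k (bpt (Sum.inr κ)) - eF n k 0)
        = p (Sum.inr κ) * Whatbucket κ n k - p (Sum.inr κ) * Winf n k := by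
      intro κ
      rw [show bpt (Sum.inr κ) = -(1 / ((κ : ℝ) + 1)) from rfl, eF_What, eF_inf]; ring
    have hms := mix_summable hp n k
    have hspl := Summable.tsum_sum (hms.comp_injective Sum.inl_injective)
      (hms.comp_injective Sum.inr_injective)
    rw [tsum_congr e1, tsum_congr e2, (w1 n k).tsum_sub (s1.mul_right _),
      (w2 n k).tsum_sub (s2.mul_right _), tsum_mul_right, tsum_mul_right] at hspl
    rw [← hpV]
    unfold mix
    rw [hspl, eF_inf, hsum]
    ring
  · rintro ⟨p, q, r⟩ ⟨p', q', r'⟩ ⟨-, -, -, hp, hq, -, h⟩ ⟨-, -, -, hp', hq', -, h'⟩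
    simp only at hp hq h hp' hq' h'
    obtain ⟨h1, h2, h3⟩ := integ_unique (hp.sub hp') (hq.sub hq') (r - r') (by
      intro n k
      have := integ_diff hp hq hp' hq' r r' (eF_cont n k)
      rw [integ_eq p, integ_eq p', ← (h n k).2.2, ← (h' n k).2.2, sub_self] at this
      exact this)
    have h1' : p = p' := sub_eq_zero.1 h1
    have h2' : q = q' := sub_eq_zero.1 h2
    have h3' : r = r' := sub_eq_zero.1 h3
    rw [h1', h2', h3']
end
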